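/- arXiv:2010.00119 — 8 statements merged into one kernel-verified Lean document; each statement's English description precedes it below -/
import Mathlib

section
/- There exist absolute constants C > 0 and ε > 0 such that for every finite set A of real numbers, |A + √2·A| ≥ (1+√2)²·|A| − C·|A|^(1−ε). -/
open Finset
open scoped Pointwise


lemma exists_enum {G : Type*} [DecidableEq G] [Inhabited G] (X : Finset G) (f : G → ℕ) :
    ∃ x : ℕ → G, (range #X).image x = X ∧ Set.InjOn x (range #X) ∧
      ∀ i j, i ≤ j → j < #X → f (x j) ≤ f (x i) := by
  induction X using Finset.induction_on_min_value f with
  | empty => exact ⟨fun _ => default, by simp, by simp, by simp⟩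
  | @insert a s ha hmin ih =>
    obtain ⟨x, hx, hinj, hmono⟩ := ih
    have hmem : ∀ i, i < #s → x i ∈ s := fun i hi => by
      have : x i ∈ (range #s).image x := mem_image_of_mem x (mem_range.2 hi)
      rwa [hx] at this
    have himg : (range #(insert a s)).image (fun i => if i < #s then x i else a) = insert a s := by
      rw [card_insert_of_notMem ha, range_add_one, image_insert]
      simp only [lt_irrefl, if_false]
      congr 1
      conv_rhs => rw [← hx]
      apply image_congr
      intro i hi
      simp only [coe_range, Set.mem_Iio] at hi
      simp [hi]
    refine ⟨fun i => if i < #s then x i else a, himg, ?_, ?_⟩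
    · rw [← card_image_iff, himg, card_range]
    · intro i j hij hj
      rw [card_insert_of_notMem ha] at hj
      by_cases h1 : j < #s
      · have h2 : i < #s := by omega
        simpa [h1, h2] using hmono i j hij h1
      · by_cases h2 : i < #s
        · simpa [h1, h2] using hmin _ (hmem i h2)
        · simp [h1, h2]

lemma sum_range_div (h : ℕ → ℤ) (m k : ℕ) (hk : 0 < k) :
    ∑ u ∈ range (m * k), h (u / k) = k * ∑ i ∈ range m, h i := by
  induction m with
  | zero => simp
  | succ m ih =>
    rw [Nat.succ_mul, sum_range_add, ih, sum_range_succ, mul_add]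
    congr 1
    rw [sum_congr rfl (g := fun _ => h m)]
    · simp
    · intro u hu
      rw [mem_range] at hu
      congr 1
      rw [mul_comm, Nat.mul_add_div hk, Nat.div_eq_of_lt hu, add_zero]

lemma path_sum (m n M p q b c S : ℕ) (hm0 : 0 < m) (hn0 : 0 < n) (f g F : ℕ → ℕ)
    (hp : ∀ i, f i ≤ p) (hq : ∀ i, g i ≤ q)
    (key : ∀ i < m, ∀ j < n, i + j < M ∧ f i + g j ≤ F (i + j) + 1)
    (hzm : ∀ i j, i ≤ j → j < M → F j ≤ F i)
    (sumB : ∑ i ∈ range m, (f i : ℤ) = b)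
    (sumC : ∑ i ∈ range n, (g i : ℤ) = c)
    (sumZ : ∑ i ∈ range M, (F i : ℤ) = S) :
    ((m : ℤ) + n) * (n * b + m * c - m * n) ≤ (m * n) * (S + p + q) := by
  have hmn := key (m-1) (by omega) (n-1) (by omega)
  let Φ : ℕ → ℤ := fun r => if r = 0 then (p + q : ℤ) else F (r - 1)
  have pt : ∀ u ∈ range ((m + n) * (m * n)),
      (f (u / (n * (m + n))) : ℤ) + g (u / (m * (m + n))) - 1 ≤ Φ (u / (m * n)) := by
    intro u hu
    rw [mem_range] at hu
    have hi : u / (n * (m + n)) < m := by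
      rw [Nat.div_lt_iff_lt_mul (by positivity)]; linarith
    have hj : u / (m * (m + n)) < n := by
      rw [Nat.div_lt_iff_lt_mul (by positivity)]; linarith
    have hr : u / (m * n) < u / (n * (m + n)) + u / (m * (m + n)) + 2 := by
      rw [Nat.div_lt_iff_lt_mul (by positivity)]
      have h1 := Nat.lt_div_mul_add (a := u) (b := n * (m + n)) (by positivity)
      have h2 := Nat.lt_div_mul_add (a := u) (b := m * (m + n)) (by positivity)
      set a := u / (n * (m + n))
      set b := u / (m * (m + n))
      have h3 : u * m < (a + 1) * (n * m) * (m + n) := by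
        calc u * m < (a * (n * (m + n)) + n * (m + n)) * m := Nat.mul_lt_mul_of_pos_right h1 hm0
          _ = _ := by ring
      have h4 : u * n < (b + 1) * (n * m) * (m + n) := by
        calc u * n < (b * (m * (m + n)) + m * (m + n)) * n := Nat.mul_lt_mul_of_pos_right h2 hn0
          _ = _ := by ring
      have h5 : u * (m + n) < ((a + b + 2) * (m * n)) * (m + n) := by nlinarith
      exact lt_of_mul_lt_mul_right h5 (Nat.zero_le _)
    have hk := key _ hi _ hj
    have hr1 : u / (m * n) - 1 ≤ u / (n * (m + n)) + u / (m * (m + n)) :=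
      Nat.sub_le_of_le_add (Nat.lt_succ_iff.1 hr)
    simp only [Φ]
    split_ifs with h0
    · have := hp (u / (n * (m + n)))
      have := hq (u / (m * (m + n)))
      omega
    · have := hzm (u / (m * n) - 1) _ hr1 hk.1
      have hk2 := hk.2
      zify at *
      linarith
  have HS := sum_le_sum pt
  rw [sum_range_div Φ (m + n) (m * n) (by positivity)] at HS
  rw [sum_sub_distrib, sum_add_distrib] at HS
  have e1 : (m + n) * (m * n) = m * (n * (m + n)) := by ring
  have e2 : (m + n) * (m * n) = n * (m * (m + n)) := by ring
  have s1 : ∑ u ∈ range ((m + n) * (m * n)), (f (u / (n * (m + n))) : ℤ)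
      = n * (m + n) * b := by
    rw [e1, sum_range_div (fun i => (f i : ℤ)) _ _ (by positivity), sumB]; push_cast; rfl
  have s2 : ∑ u ∈ range ((m + n) * (m * n)), (g (u / (m * (m + n))) : ℤ)
      = m * (m + n) * c := by
    rw [e2, sum_range_div (fun i => (g i : ℤ)) _ _ (by positivity), sumC]; push_cast; rfl
  have s3 : ∑ r ∈ range (m + n), Φ r ≤ p + q + S := by
    obtain ⟨k, hk⟩ : ∃ k, m + n = k + 1 := ⟨m + n - 1, by omega⟩
    rw [hk, sum_range_succ', ← sumZ]
    have : ∑ i ∈ range k, Φ (i + 1) ≤ ∑ i ∈ range M, (F i : ℤ) := by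
      have e : ∑ i ∈ range k, Φ (i + 1) = ∑ i ∈ range k, (F i : ℤ) := by
        apply sum_congr rfl; intro i _; simp [Φ]
      rw [e]
      apply sum_le_sum_of_subset_of_nonneg
      · intro i; simp only [mem_range]; omega
      · intros; positivity
    have h0 : Φ 0 = p + q := by simp [Φ]
    rw [h0]; linarith
  rw [s1, s2] at HS
  simp only [sum_const, card_range, nsmul_eq_mul, mul_one] at HS
  push_cast at HS
  have s4 : (m * n : ℤ) * ∑ r ∈ range (m + n), Φ r ≤ (m * n : ℤ) * (p + q + S) :=
    mul_le_mul_of_nonneg_left s3 (by positivity)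
  nlinarith

lemma lines_ineq {G : Type*} [AddCommGroup G] [IsAddTorsionFree G] [DecidableEq G]
    (π : ℝ →+ G) (B C : Finset ℝ) (hB : B.Nonempty) (hC : C.Nonempty) (p q : ℕ)
    (hp : ∀ x, #(B.filter (fun b => π b = x)) ≤ p)
    (hq : ∀ x, #(C.filter (fun b => π b = x)) ≤ q) :
    ((#(B.image π) : ℤ) + #(C.image π)) *
      (#(C.image π) * #B + #(B.image π) * #C - #(B.image π) * #(C.image π)) ≤
      (#(B.image π) * #(C.image π)) * (#(B + C) + p + q) := by
  classical
  have : Inhabited G := ⟨0⟩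
  set X := B.image π with hX
  set Y := C.image π with hY
  set Z := (B + C).image π with hZ
  set f : G → ℕ := fun x => #(B.filter (fun b => π b = x)) with hf
  set g : G → ℕ := fun x => #(C.filter (fun b => π b = x)) with hg
  set F : G → ℕ := fun x => #((B + C).filter (fun b => π b = x)) with hF
  have hFfg : ∀ x ∈ X, ∀ y ∈ Y, x + y ∈ Z ∧ f x + g y ≤ F (x + y) + 1 := by
    intro x hx y hy
    obtain ⟨b, hb, rfl⟩ := mem_image.1 hx
    obtain ⟨c, hc, rfl⟩ := mem_image.1 hy
    constructor
    · rw [← map_add]; exact mem_image_of_mem _ (add_mem_add hb hc)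
    · have h1 := cauchy_davenport_of_isAddTorsionFree
        (s := B.filter (fun b' => π b' = π b)) (t := C.filter (fun c' => π c' = π c))
        ⟨b, by simp [hb]⟩ ⟨c, by simp [hc]⟩
      have h2 : B.filter (fun b' => π b' = π b) + C.filter (fun c' => π c' = π c) ⊆
          (B + C).filter (fun s => π s = π b + π c) := by
        intro s hs
        obtain ⟨b', hb', c', hc', rfl⟩ := mem_add.1 hs
        rw [mem_filter] at *
        exact ⟨add_mem_add hb'.1 hc'.1, by rw [map_add, hb'.2, hc'.2]⟩
      have h3 := card_le_card h2
      simp only [hf, hg, hF]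
      omega
  obtain ⟨x, hx, hxi, hxm⟩ := exists_enum X f
  obtain ⟨y, hy, hyi, hym⟩ := exists_enum Y g
  obtain ⟨z, hz, hzi, hzm⟩ := exists_enum Z F
  set m := #X with hm
  set n := #Y with hn
  have hm0 : 0 < m := card_pos.2 (hB.image _)
  have hn0 : 0 < n := card_pos.2 (hC.image _)
  have hxX : ∀ i < m, x i ∈ X := fun i hi => by
    rw [← hx]; exact mem_image_of_mem x (mem_range.2 hi)
  have hyY : ∀ i < n, y i ∈ Y := fun i hi => by
    rw [← hy]; exact mem_image_of_mem y (mem_range.2 hi)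
  have key : ∀ i < m, ∀ j < n, i + j < #Z ∧ f (x i) + g (y j) ≤ F (z (i + j)) + 1 := by
    intro i hi j hj
    have c1 : #((range (i+1)).image x) = i + 1 := by
      rw [card_image_of_injOn, card_range]
      exact hxi.mono (by intro a; simp; omega)
    have c2 : #((range (j+1)).image y) = j + 1 := by
      rw [card_image_of_injOn, card_range]
      exact hyi.mono (by intro a; simp; omega)
    have cd := cauchy_davenport_of_isAddTorsionFree
        (s := (range (i+1)).image x) (t := (range (j+1)).image y)
        (by simp) (by simp)
    have sub : (range (i+1)).image x + (range (j+1)).image y ⊆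
        Z.filter (fun t => f (x i) + g (y j) ≤ F t + 1) := by
      intro t ht
      obtain ⟨a, ha, b, hb, rfl⟩ := mem_add.1 ht
      obtain ⟨i', hi', rfl⟩ := mem_image.1 ha
      obtain ⟨j', hj', rfl⟩ := mem_image.1 hb
      rw [mem_range] at hi' hj'
      have h1 := hFfg _ (hxX i' (by omega)) _ (hyY j' (by omega))
      have h2 := hxm i' i (by omega) hi
      have h3 := hym j' j (by omega) hj
      rw [mem_filter]
      exact ⟨h1.1, by omega⟩
    have h4 := card_le_card sub
    have h5 := card_filter_le Z (fun t => f (x i) + g (y j) ≤ F t + 1)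
    have h6 : i + j < #Z := by omega
    refine ⟨h6, ?_⟩
    by_contra hcon
    have sub2 : Z.filter (fun t => f (x i) + g (y j) ≤ F t + 1) ⊆ (range (i+j)).image z := by
      intro t ht
      rw [mem_filter] at ht
      have htZ := ht.1
      rw [← hz] at htZ
      obtain ⟨r, hr, rfl⟩ := mem_image.1 htZ
      rw [mem_range] at hr
      refine mem_image_of_mem _ (mem_range.2 ?_)
      by_contra hr2
      have := hzm (i+j) r (by omega) hr
      omega
    have h7 := card_le_card sub2
    have h8 : #((range (i+j)).image z) ≤ i + j := card_image_le.trans (by simp)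
    omega
  have sumB : ∑ i ∈ range m, (f (x i) : ℤ) = #B := by
    rw [card_eq_sum_card_image π B, ← hX, ← hx, sum_image hxi]
    push_cast; rfl
  have sumC : ∑ i ∈ range n, (g (y i) : ℤ) = #C := by
    rw [card_eq_sum_card_image π C, ← hY, ← hy, sum_image hyi]
    push_cast; rfl
  have sumZ : ∑ i ∈ range #Z, (F (z i) : ℤ) = #(B + C) := by
    rw [card_eq_sum_card_image π (B+C), ← hZ]
    conv_rhs => rw [← hz]
    rw [sum_image hzi]
    push_cast; rfl
  exact path_sum m n #Z p q #B #C #(B + C) hm0 hn0 (fun i => f (x i)) (fun i => g (y i))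
    (fun i => F (z i)) (fun i => hp _) (fun i => hq _) key hzm sumB sumC sumZ


noncomputable def dil (A : Finset ℝ) : Finset ℝ := A.image (fun a => Real.sqrt 2 * a)

lemma sqrt_two_pos' : (0:ℝ) < Real.sqrt 2 := Real.sqrt_pos.2 (by norm_num)

lemma card_dil (A : Finset ℝ) : #(dil A) = #A :=
  card_image_of_injective _ (mul_right_injective₀ sqrt_two_pos'.ne')

lemma mem_dil {A : Finset ℝ} {x : ℝ} : x ∈ dil A ↔ ∃ a ∈ A, Real.sqrt 2 * a = x := by
  simp [dil]

lemma dil_nonempty {A : Finset ℝ} (hA : A.Nonempty) : (dil A).Nonempty := hA.image _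

lemma plun (A : Finset ℝ) (hA : A.Nonempty) (h : #(A + dil A) ≤ 6 * #A) (m n : ℕ) :
    #(m • A - n • A) ≤ 6 ^ (m + n) * #A := by
  have h1 := pluennecke_ruzsa_inequality_nsmul_sub_nsmul_add (dil_nonempty hA) A m n
  rw [card_dil, add_comm (dil A)] at h1
  have hpos : (0 : ℚ≥0) < #A := by exact_mod_cast card_pos.2 hA
  have h2 : (#(A + dil A) / #A : ℚ≥0) ≤ 6 := by
    rw [div_le_iff₀ hpos]; exact_mod_cast h
  have h3 : (#(m • A - n • A) : ℚ≥0) ≤ 6 ^ (m + n) * #A :=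
    h1.trans (by gcongr)
  exact_mod_cast h3

/-- covering data -/
lemma covering (A : Finset ℝ) (hA : A.Nonempty) (h : #(A + dil A) ≤ 6 * #A) :
    ∃ X Y : Finset ℝ, #X ≤ 6 ^ 5 ∧ #Y ≤ 6 ^ 7 ∧ (A - A) + (A - A) ⊆ X + (A - A) ∧
      dil (A - A) ⊆ Y + (A - A) := by
  have e1 : (A - A) + (A - A) + A = 3 • A - 2 • A := by
    rw [show 3 = 1 + 1 + 1 from rfl, add_nsmul, add_nsmul, one_nsmul]
    simp only [sub_eq_add_neg, neg_add]
    generalize -A = A'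
    abel
  have c1 := plun A hA h 3 2
  rw [← e1] at c1
  obtain ⟨X, -, hX, hXc⟩ := ruzsa_covering_add (K := ((6:ℝ) ^ 5)) (A := (A - A) + (A - A)) hA
    (by exact_mod_cast c1)
  rw [add_comm] at h
  obtain ⟨W, -, hW, hWc⟩ := ruzsa_covering_add (K := (6:ℝ)) (A := dil A) hA
    (by exact_mod_cast h)
  have hX' : #X ≤ 6 ^ 5 := by exact_mod_cast hX
  have hW' : #W ≤ 6 := by exact_mod_cast hW
  refine ⟨X, (W - W) + X, hX', ?_, hXc, ?_⟩
  · calc #((W - W) + X) ≤ #(W - W) * #X := card_add_le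
      _ ≤ (#W * #W) * #X := by gcongr; exact card_sub_le
      _ ≤ (6 * 6) * 6 ^ 5 := by gcongr
      _ = 6 ^ 7 := by norm_num
  · intro t ht
    obtain ⟨d, hd, rfl⟩ := mem_dil.1 ht
    obtain ⟨a, ha, b, hb, rfl⟩ := mem_sub.1 hd
    obtain ⟨w, hw, r, hr, h1⟩ := mem_add.1 (hWc (mem_dil.2 ⟨a, ha, rfl⟩))
    obtain ⟨w', hw', r', hr', h2⟩ := mem_add.1 (hWc (mem_dil.2 ⟨b, hb, rfl⟩))
    have hr2 : -r' ∈ A - A := by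
      obtain ⟨u, hu, v, hv, rfl⟩ := mem_sub.1 hr'
      rw [neg_sub]; exact sub_mem_sub hv hu
    obtain ⟨x, hx, s, hs, h3⟩ := mem_add.1 (hXc (add_mem_add hr hr2))
    rw [mem_add]
    refine ⟨w - w' + x, add_mem_add (sub_mem_sub hw hw') hx, s, hs, ?_⟩
    linarith

lemma direction (A : Finset ℝ) (hA : A.Nonempty) (h : #(A + dil A) ≤ 6 * #A) (j : ℕ)
    (hj : (6 ^ 7) ^ j < #A) :
    ∃ w : ℝ, w ≠ 0 ∧ ∀ i ≤ j, Real.sqrt 2 ^ i * w ∈ (A - A) + (A - A) := by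
  classical
  obtain ⟨X, Y, hX, hY, hXc, hYc⟩ := covering A hA h
  have hch : ∀ d : ℝ, ∃ yr : ℝ × ℝ, d ∈ A - A → yr.1 ∈ Y ∧ yr.2 ∈ A - A ∧
      Real.sqrt 2 * d = yr.1 + yr.2 := by
    intro d
    by_cases hd : d ∈ A - A
    · obtain ⟨y, hy, r, hr, e⟩ := mem_add.1 (hYc (mem_dil.2 ⟨d, hd, rfl⟩))
      exact ⟨(y, r), fun _ => ⟨hy, hr, e.symm⟩⟩
    · exact ⟨(0, 0), fun h => absurd h hd⟩
  choose yr hyr using hch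
  let r : ℝ → ℝ := fun d => (yr d).2
  have hr : ∀ d ∈ A - A, ∀ i, r^[i] d ∈ A - A := by
    intro d hd i
    induction i with
    | zero => exact hd
    | succ i ih => rw [Function.iterate_succ_apply']; exact (hyr _ ih).2.1
  let code : ℝ → (Fin j → ℝ) := fun d i => (yr (r^[i] d)).1
  have hcard : #(Fintype.piFinset (fun _ : Fin j => Y)) < #(A - A) := by
    rw [Fintype.card_piFinset]
    simp only [prod_const, card_univ, Fintype.card_fin]
    calc #Y ^ j ≤ (6 ^ 7) ^ j := by gcongr
      _ < #A := hj
      _ ≤ #(A - A) := card_le_card_sub_right hA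
  have hmaps : ∀ d ∈ A - A, code d ∈ Fintype.piFinset (fun _ : Fin j => Y) := by
    intro d hd
    rw [Fintype.mem_piFinset]
    intro i
    exact (hyr _ (hr d hd i)).1
  obtain ⟨d, hd, d', hd', hne, heq⟩ := exists_ne_map_eq_of_card_lt_of_maps_to hcard hmaps
  have hind : ∀ i ≤ j, Real.sqrt 2 ^ i * (d - d') = r^[i] d - r^[i] d' := by
    intro i
    induction i with
    | zero => intro _; simp
    | succ i ih =>
      intro hi
      have h1 := ih (by omega)
      have h2 := (hyr _ (hr d hd i)).2.2
      have h3 := (hyr _ (hr d' hd' i)).2.2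
      have h4 := congrFun heq ⟨i, by omega⟩
      simp only [code] at h4
      rw [Function.iterate_succ_apply', Function.iterate_succ_apply', pow_succ', mul_assoc, h1,
        mul_sub, h2, h3, h4]
      simp only [r]
      ring
  refine ⟨d - d', sub_ne_zero.2 hne, fun i hi => ?_⟩
  rw [hind i hi, sub_eq_add_neg (r^[i] d)]
  refine add_mem_add (hr d hd i) ?_
  obtain ⟨u, hu, v, hv, e⟩ := mem_sub.1 (hr d' hd' i)
  rw [← e, neg_sub]; exact sub_mem_sub hv hu

lemma card_nsmul_le' (X : Finset ℝ) (k : ℕ) : #(k • X) ≤ (k + 1) ^ #X := by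
  classical
  have : k • X ⊆ (Fintype.piFinset (fun _ : X => range (k + 1))).image
      (fun f => ∑ x : X, (f x : ℝ) * x) := by
    induction k with
    | zero =>
      intro t ht
      simp only [zero_nsmul, mem_zero] at ht
      subst ht
      rw [mem_image]
      exact ⟨fun _ => 0, by simp, by simp⟩
    | succ k ih =>
      intro t ht
      rw [succ_nsmul] at ht
      obtain ⟨u, hu, v, hv, rfl⟩ := mem_add.1 ht
      obtain ⟨f, hf, rfl⟩ := mem_image.1 (ih hu)
      rw [Fintype.mem_piFinset] at hf
      rw [mem_image]
      refine ⟨fun x => f x + if x = ⟨v, hv⟩ then 1 else 0, ?_, ?_⟩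
      · rw [Fintype.mem_piFinset]
        intro x
        have := hf x
        rw [mem_range] at *
        split_ifs <;> omega
      · push_cast
        simp only [add_mul, sum_add_distrib]
        congr 1
        simp
  calc _ ≤ _ := card_le_card this
    _ ≤ _ := card_image_le
    _ = _ := by simp

lemma growth (A : Finset ℝ) (hA : A.Nonempty) (h : #(A + dil A) ≤ 6 * #A) (k : ℕ) :
    #(A + k • (A - A)) ≤ (k + 1) ^ (6 ^ 5) * (6 ^ 3 * #A) := by
  obtain ⟨X, Y, hX, hY, hXc, hYc⟩ := covering A hA h
  have h0 : (0 : ℝ) ∈ A - A := by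
    obtain ⟨a, ha⟩ := hA
    exact mem_sub.2 ⟨a, ha, a, ha, sub_self a⟩
  have hs : k • (A - A) ⊆ k • X + (A - A) := by
    induction k with
    | zero => simpa using h0
    | succ k ih =>
      rw [succ_nsmul, succ_nsmul, add_assoc]
      calc k • (A - A) + (A - A) ⊆ (k • X + (A - A)) + (A - A) := add_subset_add_right ih
        _ = k • X + ((A - A) + (A - A)) := add_assoc _ _ _
        _ ⊆ _ := add_subset_add_left hXc
  have e : A + (A - A) = 2 • A - 1 • A := by rw [two_nsmul, one_nsmul, add_sub_assoc]
  calc #(A + k • (A - A)) ≤ #(k • X + (A + (A - A))) := by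
        apply card_le_card
        rw [← add_assoc, add_comm (k • X), add_assoc]
        exact add_subset_add_left hs
    _ ≤ #(k • X) * #(A + (A - A)) := card_add_le
    _ ≤ (k + 1) ^ #X * (6 ^ 3 * #A) := by
        gcongr
        · exact card_nsmul_le' X k
        · rw [e]; exact plun A hA h 2 1
    _ ≤ _ := by gcongr; omega

lemma mult_mem (D : Finset ℝ) (h0 : (0:ℝ) ∈ D) (w : ℝ) (h : ℕ)
    (hw : ∀ i < h, 2 ^ i * w ∈ D + D) (n : ℕ) (hn : n < 2 ^ h) :
    (n : ℝ) * w ∈ (2 * h) • D := by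
  induction h generalizing n with
  | zero => 
    have : n = 0 := by simpa using hn
    simp [this]
  | succ h ih =>
    rw [mul_add, add_nsmul, mul_one, two_nsmul D]
    rw [pow_succ] at hn
    by_cases h1 : n < 2 ^ h
    · rw [← add_zero ((n : ℝ) * w)]
      refine add_mem_add (ih (fun i hi => hw i (by omega)) n h1) ?_
      rw [← add_zero (0:ℝ)]; exact add_mem_add h0 h0
    · have e : (n : ℝ) * w = ((n - 2 ^ h : ℕ) : ℝ) * w + 2 ^ h * w := by
        rw [Nat.cast_sub (by omega)]; push_cast; ring
      rw [e]
      exact add_mem_add (ih (fun i hi => hw i (by omega)) _ (by omega)) (hw h (by omega))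

/-- number of lines times length -/
lemma lines_count (A E : Finset ℝ) (w : ℝ) (hw : w ≠ 0) (L : ℕ)
    (hE : ∀ n < L, (n : ℝ) * w ∈ E) [DecidableEq (ℝ ⧸ (Submodule.span ℚ {w}))] :
    #(A.image (Submodule.span ℚ {w}).mkQ) * L ≤ #(A + E) := by
  classical
  set π := (Submodule.span ℚ {w}).mkQ with hπ
  have hrep : ∀ x ∈ A.image π, ∃ a ∈ A, π a = x := fun x hx => by simpa using hx
  choose! rep hrA hrπ using hrep
  have hπw : ∀ n : ℕ, π ((n : ℝ) * w) = 0 := by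
    intro n
    rw [hπ, Submodule.mkQ_apply, Submodule.Quotient.mk_eq_zero, Submodule.mem_span_singleton]
    exact ⟨n, by rw [Rat.smul_def]; simp⟩
  rw [← card_range L, ← card_product]
  apply card_le_card_of_injOn (fun t => rep t.1 + (t.2 : ℝ) * w)
  · rintro ⟨x, n⟩ ht
    simp only [coe_product, Set.mem_prod, mem_coe, mem_range] at ht
    exact add_mem_add (hrA x ht.1) (hE n ht.2)
  · rintro ⟨x, n⟩ ht ⟨x', n'⟩ ht' heq
    simp only [coe_product, Set.mem_prod, mem_coe, mem_range] at ht ht'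
    dsimp only at heq
    have h1 := congrArg π heq
    rw [map_add, map_add, hπw, hπw, hrπ x ht.1, hrπ x' ht'.1, add_zero, add_zero] at h1
    subst h1
    have h2 : (n : ℝ) * w = n' * w := by linarith
    have h3 : (n : ℝ) = n' := mul_right_cancel₀ hw h2
    have h4 : n = n' := by exact_mod_cast h3
    rw [h4]

lemma fiber_bound (A S : Finset ℝ) (hS : S ⊆ A) (w : ℝ) (hw : w ≠ 0)
    (hd : ∀ a ∈ S, ∀ b ∈ S, ∃ t : ℚ, a - b = t * w) :
    #S ^ 2 ≤ #(A + dil A) := by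
  rw [sq, ← card_product]
  apply card_le_card_of_injOn (fun t => t.1 + Real.sqrt 2 * t.2)
  · rintro ⟨a, b⟩ ht
    simp only [coe_product, Set.mem_prod, mem_coe] at ht
    exact add_mem_add (hS ht.1) (mem_dil.2 ⟨b, hS ht.2, rfl⟩)
  · rintro ⟨a, b⟩ ht ⟨a', b'⟩ ht' heq
    simp only [coe_product, Set.mem_prod, mem_coe] at ht ht'
    dsimp only at heq
    obtain ⟨t, h1⟩ := hd a ht.1 a' ht'.1
    obtain ⟨u, h2⟩ := hd b ht.2 b' ht'.2
    have h3 : ((t : ℝ) + Real.sqrt 2 * u) * w = 0 := by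
      linear_combination heq - h1 - Real.sqrt 2 * h2
    have h4 := (mul_eq_zero.1 h3).resolve_right hw
    have hu : u = 0 := by
      by_contra hu
      apply irrational_sqrt_two
      refine ⟨-t / u, ?_⟩
      have : (u : ℝ) ≠ 0 := by exact_mod_cast hu
      push_cast
      field_simp
      linarith
    subst hu
    have ht0 : (t : ℝ) = 0 := by simpa using h4
    rw [ht0] at h1
    simp only [Rat.cast_zero, zero_mul] at h1 h2
    rw [sub_eq_zero.1 h1, sub_eq_zero.1 h2]


lemma mkQ_eq_iff' (w a b : ℝ) (h : (Submodule.span ℚ {w}).mkQ a = (Submodule.span ℚ {w}).mkQ b) :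
    ∃ t : ℚ, a - b = t * w := by
  rw [Submodule.mkQ_apply, Submodule.mkQ_apply, Submodule.Quotient.eq,
    Submodule.mem_span_singleton] at h
  obtain ⟨t, ht⟩ := h
  exact ⟨t, by rw [← ht, Rat.smul_def]⟩

lemma dil_add (A B : Finset ℝ) : dil (A + B) = dil A + dil B := by
  ext x
  simp only [mem_dil, mem_add]
  constructor
  · rintro ⟨_, ⟨a, ha, b, hb, rfl⟩, rfl⟩
    exact ⟨_, ⟨a, ha, rfl⟩, _, ⟨b, hb, rfl⟩, by ring⟩
  · rintro ⟨_, ⟨a, ha, rfl⟩, _, ⟨b, hb, rfl⟩, rfl⟩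
    exact ⟨_, ⟨a, ha, b, hb, rfl⟩, by ring⟩

lemma core (A B : Finset ℝ) (hA : A.Nonempty) (hB : B.Nonempty) (hBA : B ⊆ A)
    (hd : #(A + dil A) ≤ 6 * #A) (h2 : 2 * #B ≤ #A) (h : ℕ) (hh : (6 ^ 7) ^ (2 * h + 1) < #A) :
    ∃ m n p : ℕ, m * 2 ^ h ≤ (2 * h + 1) ^ (6 ^ 5) * (6 ^ 3 * #A) ∧
      n * 2 ^ h ≤ (2 * h + 1) ^ (6 ^ 5) * (6 ^ 3 * #A) ∧ p ^ 2 ≤ 6 * #A ∧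
      (1 + Real.sqrt 2) ^ 2 * (#B : ℝ) ≤ #(B + dil A) + m + n + 2 * p := by
  classical
  obtain ⟨w0, hw0, hw⟩ := direction A hA hd _ hh
  set D := A - A with hD
  have h0 : (0 : ℝ) ∈ D := by
    obtain ⟨a, ha⟩ := hA
    exact mem_sub.2 ⟨a, ha, a, ha, sub_self a⟩
  have hs : Real.sqrt 2 ^ 2 = 2 := Real.sq_sqrt (by norm_num)
  set w := Real.sqrt 2 * w0 with hwdef
  have hwne : w ≠ 0 := mul_ne_zero sqrt_two_pos'.ne' hw0
  have E0 : ∀ n : ℕ, n < 2 ^ h → (n : ℝ) * w0 ∈ (2 * h) • D :=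
    mult_mem D h0 w0 h (fun i hi => by
      have := hw (2 * i) (by omega)
      rwa [pow_mul, hs] at this)
  have E1 : ∀ n : ℕ, n < 2 ^ h → (n : ℝ) * w ∈ (2 * h) • D :=
    mult_mem D h0 w h (fun i hi => by
      have := hw (2 * i + 1) (by omega)
      rwa [pow_succ, pow_mul, hs, mul_assoc] at this)
  have E2 : ∀ n : ℕ, n < 2 ^ h → (n : ℝ) * w ∈ dil ((2 * h) • D) := fun n hn =>
    mem_dil.2 ⟨_, E0 n hn, by rw [hwdef]; ring⟩
  set V := Submodule.span ℚ {w} with hV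
  have m1 := lines_count B ((2 * h) • D) w hwne (2 ^ h) E1
  have n1 := lines_count (dil A) (dil ((2 * h) • D)) w hwne (2 ^ h) E2
  rw [← dil_add, card_dil] at n1
  have gr := growth A hA hd (2 * h)
  have fib1 : ∀ x, #(B.filter (fun b => V.mkQ.toAddMonoidHom b = x)) ≤ Nat.sqrt (6 * #A) := by
    intro x
    rw [Nat.le_sqrt']
    refine le_trans (fiber_bound A _ ((filter_subset _ _).trans hBA) w hwne ?_) hd
    intro a ha b hb
    rw [mem_filter] at ha hb
    exact mkQ_eq_iff' w a b (ha.2.trans hb.2.symm)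
  have fib2 : ∀ x, #((dil A).filter (fun b => V.mkQ.toAddMonoidHom b = x))
      ≤ Nat.sqrt (6 * #A) := by
    intro x
    rw [Nat.le_sqrt']
    have e : (dil A).filter (fun b => V.mkQ.toAddMonoidHom b = x) =
        dil (A.filter (fun a => V.mkQ.toAddMonoidHom (Real.sqrt 2 * a) = x)) := by
      ext t
      simp only [mem_filter, mem_dil]
      constructor
      · rintro ⟨⟨a, ha, rfl⟩, h⟩; exact ⟨a, ⟨ha, h⟩, rfl⟩
      · rintro ⟨a, ⟨ha, h⟩, rfl⟩; exact ⟨⟨a, ha, rfl⟩, h⟩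
    rw [e, card_dil]
    refine le_trans (fiber_bound A _ (filter_subset _ _) w0 hw0 ?_) hd
    intro a ha b hb
    rw [mem_filter] at ha hb
    obtain ⟨t, ht⟩ := mkQ_eq_iff' w _ _ (ha.2.trans hb.2.symm)
    refine ⟨t, ?_⟩
    apply mul_left_cancel₀ sqrt_two_pos'.ne'
    rw [hwdef] at ht
    linear_combination ht
  have : IsAddTorsionFree (ℝ ⧸ V) := ⟨fun n hn x y hxy => by
    have hn' : (n : ℚ) ≠ 0 := by exact_mod_cast hn
    have hxy' : (n : ℚ) • x = (n : ℚ) • y := by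
      simpa only [Nat.cast_smul_eq_nsmul] using hxy
    have := congrArg (fun t => (n : ℚ)⁻¹ • t) hxy'
    simpa only [inv_smul_smul₀ hn'] using this⟩
  have L := lines_ineq V.mkQ.toAddMonoidHom B (dil A) hB (dil_nonempty hA) _ _ fib1 fib2
  change ((#(B.image V.mkQ) : ℤ) + #((dil A).image V.mkQ)) *
      (#((dil A).image V.mkQ) * #B + #(B.image V.mkQ) * #(dil A) -
        #(B.image V.mkQ) * #((dil A).image V.mkQ)) ≤
      (#(B.image V.mkQ) * #((dil A).image V.mkQ)) * (#(B + dil A) + _ + _) at L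
  have hm0 : 0 < #(B.image V.mkQ) := card_pos.2 (hB.image _)
  have hn0 : 0 < #((dil A).image V.mkQ) := card_pos.2 ((dil_nonempty hA).image _)
  refine ⟨#(B.image V.mkQ), #((dil A).image V.mkQ), Nat.sqrt (6 * #A), ?_, ?_, Nat.sqrt_le' _, ?_⟩
  · refine (m1.trans (card_le_card (add_subset_add_right hBA))).trans gr
  · exact n1.trans gr
  rw [card_dil] at L
  generalize #(B.image V.mkQ) = m at *
  generalize #((dil A).image V.mkQ) = n at *
  generalize Nat.sqrt (6 * #A) = p at *
  generalize #(B + dil A) = S at *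
  have L' : ((m : ℝ) + n) * (n * #B + m * #A - m * n) ≤ (m * n) * (S + p + p) := by
    exact_mod_cast L
  have hA2 : (2 : ℝ) * #B ≤ #A := by exact_mod_cast h2
  have hmR : (0 : ℝ) < m := by exact_mod_cast hm0
  have hnR : (0 : ℝ) < n := by exact_mod_cast hn0
  have hb : (0 : ℝ) ≤ #B := by positivity
  generalize (#B : ℝ) = b at *
  generalize (#A : ℝ) = a at *
  have hmn : (0 : ℝ) < m * n := by positivity
  have e1 : (m : ℝ) * m * (2 * b) ≤ m * m * a := by gcongr
  have e2 : (m : ℝ) * n * (2 * b) ≤ m * n * a := by gcongr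
  have e3 : 0 ≤ b * (n - Real.sqrt 2 * m) ^ 2 := by positivity
  have main : (m * n : ℝ) * ((1 + Real.sqrt 2) ^ 2 * b) ≤ (m * n) * (S + m + n + 2 * p) := by
    have e4 : b * (n - Real.sqrt 2 * m) ^ 2 =
      b * n ^ 2 - 2 * Real.sqrt 2 * (b * m * n) + 2 * b * m ^ 2 := by
      linear_combination b * m ^ 2 * hs
    have e5 : (m * n : ℝ) * ((1 + Real.sqrt 2) ^ 2 * b) =
      3 * (b * m * n) + 2 * Real.sqrt 2 * (b * m * n) := by
      linear_combination b * m * n * hs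
    rw [e5]
    rw [e4] at e3
    nlinarith
  exact le_of_mul_le_mul_left main hmn

lemma poly_bound (k : ℕ) : ∃ C : ℝ, 0 < C ∧ ∀ h : ℕ, ((2 * h + 1 : ℕ) : ℝ) ^ k ≤
    C * Real.sqrt 2 ^ h := by
  set r := Real.sqrt (Real.sqrt 2) with hr
  have h1 : 1 < Real.sqrt 2 := by
    rw [Real.lt_sqrt] <;> norm_num
  have hr1 : 1 < r := by
    rw [hr, Real.lt_sqrt] <;> simp [h1]
  have hr2 : r ^ 2 = Real.sqrt 2 := Real.sq_sqrt (by positivity)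
  have T := tendsto_pow_const_div_const_pow_of_one_lt k hr1
  obtain ⟨C, hC⟩ := T.bddAbove_range
  refine ⟨max C 1 * r, by positivity, fun h => ?_⟩
  have := hC ⟨2 * h + 1, rfl⟩
  simp only at this
  rw [div_le_iff₀ (by positivity)] at this
  calc _ ≤ C * r ^ (2 * h + 1) := this
    _ ≤ max C 1 * r ^ (2 * h + 1) := by gcongr; exact le_max_left _ _
    _ = _ := by rw [pow_succ, pow_mul, hr2]; ring

lemma alpha_le : (1 + Real.sqrt 2) ^ 2 ≤ 6 := by
  have hs : Real.sqrt 2 ^ 2 = 2 := Real.sq_sqrt (by norm_num)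
  have : Real.sqrt 2 ≤ 3 / 2 := by rw [Real.sqrt_le_left] <;> norm_num
  nlinarith

lemma key_ineq : ∃ C ε : ℝ, 0 < C ∧ 0 < ε ∧ ε ≤ 1 / 2 ∧ ∀ A B : Finset ℝ, B.Nonempty → B ⊆ A →
    #(A + dil A) ≤ 6 * #A → 2 * #B ≤ #A →
    (1 + Real.sqrt 2) ^ 2 * (#B : ℝ) - C * (#A : ℝ) ^ (1 - ε) ≤ #(B + dil A) := by
  have core' := core
  have hQ1 : 2 ≤ 6 ^ 7 := by norm_num
  generalize 6 ^ 7 = Q at core' hQ1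
  generalize 6 ^ 5 = k at core'
  obtain ⟨Cp, hCp, hpoly⟩ := poly_bound k
  set K : ℕ := Q ^ 4 with hK
  have hK1 : 2 ≤ K := hQ1.trans (Nat.le_self_pow (by norm_num) Q)
  have hK1R : (2 : ℝ) ≤ K := by exact_mod_cast hK1
  have hs1 : 1 < Real.sqrt 2 := by rw [Real.lt_sqrt] <;> norm_num
  have hs : Real.sqrt 2 * Real.sqrt 2 = 2 := Real.mul_self_sqrt (by norm_num)
  set ε := Real.logb K (Real.sqrt 2) with hε
  have hε0 : 0 < ε := Real.logb_pos (by linarith) hs1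
  have hε1 : ε ≤ 1 / 2 := by
    rw [hε, Real.logb_le_iff_le_rpow (by linarith) (by linarith), ← Real.sqrt_eq_rpow]
    exact Real.sqrt_le_sqrt hK1R
  have hKε : (K : ℝ) ^ ε = Real.sqrt 2 :=
    Real.rpow_logb (by linarith) (by linarith) (by linarith)
  refine ⟨864 * Cp + 6 + 6 * K, ε, by positivity, hε0, hε1, ?_⟩
  intro A B hB hBA hd h2
  have hA : A.Nonempty := hB.mono hBA
  have hN1 : (1 : ℝ) ≤ #A := by exact_mod_cast card_pos.2 hA
  have hNe : (1 : ℝ) ≤ (#A : ℝ) ^ (1 - ε) := Real.one_le_rpow hN1 (by linarith)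
  set h := Nat.log K #A with hh
  have hlt : #A < K ^ (h + 1) := Nat.lt_pow_succ_log_self (by omega) _
  have hle : K ^ h ≤ #A := Nat.pow_log_le_self K (card_pos.2 hA).ne'
  by_cases hz : h = 0
  · rw [hz] at hlt
    have h3 : (#A : ℝ) ≤ K := by
      rw [zero_add, pow_one] at hlt; exact_mod_cast hlt.le
    have h4 : (2 : ℝ) * #B ≤ #A := by exact_mod_cast h2
    have h5 : (1 + Real.sqrt 2) ^ 2 * (#B : ℝ) ≤ 6 * #B := by gcongr; exact alpha_le
    have h6 : (864 * Cp + 6 + 6 * K) * 1 ≤ (864 * Cp + 6 + 6 * K) * (#A : ℝ) ^ (1 - ε) := by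
      gcongr
    have h7 : (0 : ℝ) ≤ #(B + dil A) := by positivity
    have h8 : (0 : ℝ) ≤ #B := by positivity
    linarith
  · have hcond : Q ^ (2 * h + 1) < #A := by
      refine lt_of_lt_of_le ?_ hle
      rw [hK, ← pow_mul]
      exact Nat.pow_lt_pow_right (by omega) (by omega)
    obtain ⟨m, n, p, hm, hn, hp, hmain⟩ := core' A B hA hB hBA hd h2 h hcond
    clear core'
    clear_value K h ε
    have hNε : (#A : ℝ) ^ ε ≤ 2 * Real.sqrt 2 ^ h := by
      calc (#A : ℝ) ^ ε ≤ ((K : ℝ) ^ (h + 1)) ^ ε := by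
            apply Real.rpow_le_rpow (by positivity) _ hε0.le
            exact_mod_cast hlt.le
        _ = ((K : ℝ) ^ ε) ^ (h + 1) := by
            rw [← Real.rpow_natCast, ← Real.rpow_mul (by positivity), mul_comm,
              Real.rpow_mul (by positivity), Real.rpow_natCast]
        _ = Real.sqrt 2 * Real.sqrt 2 ^ h := by rw [hKε, pow_succ']
        _ ≤ _ := by gcongr; nlinarith
    have hsplit : (#A : ℝ) ^ (1 - ε) * (#A : ℝ) ^ ε = #A := by
      rw [← Real.rpow_add (by linarith)]; simp
    have hlines : ∀ m : ℕ, m * 2 ^ h ≤ (2 * h + 1) ^ k * (6 ^ 3 * #A) →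
        (m : ℝ) ≤ 432 * Cp * (#A : ℝ) ^ (1 - ε) := by
      intro m hm
      have a1 : (m : ℝ) * 2 ^ h ≤ ((2 * h + 1 : ℕ) : ℝ) ^ k * (6 ^ 3 * #A) := by
        exact_mod_cast hm
      have a2 : (m : ℝ) * 2 ^ h ≤ (Cp * Real.sqrt 2 ^ h) * (6 ^ 3 * #A) := by
        refine a1.trans ?_
        gcongr
        exact hpoly h
      have a3 : (2 : ℝ) ^ h = Real.sqrt 2 ^ h * Real.sqrt 2 ^ h := by rw [← mul_pow, hs]
      have a4 : (0 : ℝ) < Real.sqrt 2 ^ h := by positivity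
      have a5 : (m : ℝ) * Real.sqrt 2 ^ h ≤ 216 * Cp * #A := by
        rw [a3] at a2
        refine le_of_mul_le_mul_left ?_ a4
        nlinarith
      have a6 : (216 * Cp) * (#A : ℝ) ≤
          (432 * Cp * (#A : ℝ) ^ (1 - ε)) * Real.sqrt 2 ^ h := by
        calc (216 * Cp) * (#A : ℝ) = (216 * Cp * (#A : ℝ) ^ (1 - ε)) * (#A : ℝ) ^ ε := by
              rw [mul_assoc (216 * Cp) (_ ^ _), hsplit]
          _ ≤ (216 * Cp * (#A : ℝ) ^ (1 - ε)) * (2 * Real.sqrt 2 ^ h) := by gcongr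
          _ = _ := by ring
      exact le_of_mul_le_mul_right (a5.trans a6) a4
    have hp1 : (p : ℝ) ≤ 3 * (#A : ℝ) ^ (1 - ε) := by
      have b1 : (p : ℝ) ^ 2 ≤ 6 * #A := by exact_mod_cast hp
      have b2 : (p : ℝ) ≤ 3 * Real.sqrt #A := by
        apply le_of_sq_le_sq _ (by positivity)
        rw [mul_pow, Real.sq_sqrt (by positivity)]
        linarith
      refine b2.trans ?_
      rw [Real.sqrt_eq_rpow]
      gcongr
      linarith
    have := hlines m hm
    have := hlines n hn
    have h9 : (0 : ℝ) ≤ 6 * K * (#A : ℝ) ^ (1 - ε) := by positivity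
    nlinarith

lemma partition (A : Finset ℝ) (hA : 2 ≤ #A) : ∃ A0 A1 : Finset ℝ, A0.Nonempty ∧ A1.Nonempty ∧
    A0 ⊆ A ∧ A1 ⊆ A ∧ #A0 + #A1 = #A ∧
    #(A0 + dil A) + #(A1 + dil A) ≤ #(A + dil A) := by
  classical
  obtain ⟨a0, ha0, a1, ha1, hne⟩ := one_lt_card.1 hA
  set G : Finset ℝ := A.image (fun a => a - a0) ∪ dil (A.image (fun a => a - a0)) with hG
  set M := Submodule.span ℤ (G : Set ℝ) with hM
  have hs : Real.sqrt 2 * Real.sqrt 2 = 2 := Real.mul_self_sqrt (by norm_num)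
  have hGa : ∀ a ∈ A, a - a0 ∈ M := fun a ha =>
    Submodule.subset_span (by simp only [hG, mem_coe, mem_union]; exact Or.inl (mem_image_of_mem _ ha))
  have hGs : ∀ a ∈ A, Real.sqrt 2 * (a - a0) ∈ M := fun a ha =>
    Submodule.subset_span (by
      simp only [hG, mem_coe, mem_union]
      exact Or.inr (mem_dil.2 ⟨_, mem_image_of_mem _ ha, rfl⟩))
  let P : ℝ → Prop := fun a => ∃ x ∈ M, a - a0 = Real.sqrt 2 * x
  have hstep : ∀ a b a' b', b ∈ A → b' ∈ A → P a →
      a + Real.sqrt 2 * b = a' + Real.sqrt 2 * b' → P a' := by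
    rintro a b a' b' hb hb' ⟨x, hx, e⟩ h
    refine ⟨x + ((b - a0) - (b' - a0)), M.add_mem hx (M.sub_mem (hGa b hb) (hGa b' hb')), ?_⟩
    linear_combination e - h
  have hnot : ∃ a ∈ A, ¬ P a := by
    by_contra hcon
    push Not at hcon
    have hM2 : ∀ x ∈ M, Real.sqrt 2 * x ∈ M := by
      intro x hx
      refine Submodule.span_induction (p := fun x _ => Real.sqrt 2 * x ∈ M) ?_ ?_ ?_ ?_ hx
      · intro g hg
        simp only [hG, mem_coe, mem_union, mem_dil, mem_image] at hg
        rcases hg with ⟨a, ha, rfl⟩ | ⟨_, ⟨a, ha, rfl⟩, rfl⟩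
        · exact hGs a ha
        · rw [← mul_assoc, hs, two_mul]; exact M.add_mem (hGa a ha) (hGa a ha)
      · simp
      · intro x y _ _ hx hy; rw [mul_add]; exact M.add_mem hx hy
      · intro n x _ hx
        rw [mul_smul_comm]; exact M.smul_mem n hx
    have hM1 : ∀ x ∈ M, ∃ y ∈ M, x = Real.sqrt 2 * y := by
      intro x hx
      refine Submodule.span_induction (p := fun x _ => ∃ y ∈ M, x = Real.sqrt 2 * y) ?_ ?_ ?_ ?_ hx
      · intro g hg
        simp only [hG, mem_coe, mem_union, mem_dil, mem_image] at hg
        rcases hg with ⟨a, ha, rfl⟩ | ⟨_, ⟨a, ha, rfl⟩, rfl⟩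
        · exact hcon a ha
        · exact ⟨_, hGa a ha, rfl⟩
      · exact ⟨0, M.zero_mem, by simp⟩
      · rintro x y _ _ ⟨u, hu, rfl⟩ ⟨v, hv, rfl⟩; exact ⟨u + v, M.add_mem hu hv, by ring⟩
      · rintro n x _ ⟨u, hu, rfl⟩
        exact ⟨n • u, M.smul_mem n hu, by rw [mul_smul_comm]⟩
    have hle : M ≤ (Ideal.span {(2 : ℤ)}) • M := by
      intro x hx
      obtain ⟨y, hy, rfl⟩ := hM1 x hx
      obtain ⟨z, hz, rfl⟩ := hM1 y hy
      have : Real.sqrt 2 * (Real.sqrt 2 * z) = (2 : ℤ) • z := by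
        rw [← mul_assoc, hs]; simp
      rw [this]
      exact Submodule.smul_mem_smul (Ideal.mem_span_singleton_self 2) hz
    obtain ⟨r, hr, hr0⟩ := Submodule.exists_sub_one_mem_and_smul_eq_zero_of_fg_of_le_smul
      (Ideal.span {(2 : ℤ)}) M ⟨G, rfl⟩ hle
    have h1 := hr0 _ (hGa a1 ha1)
    rw [smul_eq_zero] at h1
    rcases h1 with h1 | h1
    · subst h1
      rw [Ideal.mem_span_singleton] at hr
      norm_num at hr
    · exact hne (sub_eq_zero.1 h1).symm
  refine ⟨A.filter P, A.filter (fun a => ¬ P a), ⟨a0, ?_⟩, ?_, filter_subset _ _, filter_subset _ _,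
    card_filter_add_card_filter_not _, ?_⟩
  · rw [mem_filter]; exact ⟨ha0, 0, M.zero_mem, by simp⟩
  · obtain ⟨a, ha, h⟩ := hnot; exact ⟨a, mem_filter.2 ⟨ha, h⟩⟩
  · rw [← card_union_of_disjoint]
    · exact card_le_card (union_subset (add_subset_add_right (filter_subset _ _))
        (add_subset_add_right (filter_subset _ _)))
    · rw [disjoint_left]
      intro t h1 h2
      obtain ⟨a, ha, u, hu, rfl⟩ := mem_add.1 h1
      obtain ⟨a', ha', u', hu', e⟩ := mem_add.1 h2
      obtain ⟨b, hb, rfl⟩ := mem_dil.1 hu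
      obtain ⟨b', hb', rfl⟩ := mem_dil.1 hu'
      rw [mem_filter] at ha ha'
      exact ha'.2 (hstep a b a' b' hb hb' ha.2 e.symm)

lemma main_ineq : ∃ C ε : ℝ, 0 < C ∧ 0 < ε ∧ ε ≤ 1 / 2 ∧ ∀ A : Finset ℝ,
    (1 + Real.sqrt 2) ^ 2 * (#A : ℝ) - C * (#A : ℝ) ^ (1 - ε) ≤ #(A + dil A) := by
  obtain ⟨C1, ε, hC1, hε0, hε1, hkey⟩ := key_ineq
  refine ⟨100 * C1 + 6, ε, by positivity, hε0, hε1, ?_⟩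
  suffices H : ∀ N, ∀ A : Finset ℝ, #A = N →
    (1 + Real.sqrt 2) ^ 2 * (#A : ℝ) - (100 * C1 + 6) * (#A : ℝ) ^ (1 - ε) ≤ #(A + dil A) from
    fun A => H _ A rfl
  intro N
  induction N using Nat.strong_induction_on with
  | _ N ih =>
  intro A hAN
  have hα := alpha_le
  have hS0 : (0 : ℝ) ≤ #(A + dil A) := by positivity
  rcases Nat.lt_or_ge (#A) 2 with hlt | hge
  · have h01 : #A = 0 ∨ #A = 1 := by omega
    rcases h01 with h | h
    · rw [h, Nat.cast_zero, Real.zero_rpow (by linarith)]; simp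
    · rw [h, Nat.cast_one, Real.one_rpow]; linarith
  by_cases hd : #(A + dil A) ≤ 6 * #A
  swap
  · have h1 : (6 : ℝ) * #A ≤ #(A + dil A) := by exact_mod_cast (not_le.1 hd).le
    have h2 : (1 + Real.sqrt 2) ^ 2 * (#A : ℝ) ≤ 6 * #A := by gcongr
    have h3 : 0 ≤ (100 * C1 + 6) * (#A : ℝ) ^ (1 - ε) := by positivity
    linarith
  obtain ⟨A0, A1, hA0, hA1, hs0, hs1, hc, hsum⟩ := partition A hge
  wlog hle : #A1 ≤ #A0 generalizing A0 A1
  · exact this A1 A0 hA1 hA0 hs1 hs0 (by omega) (by omega) (by omega)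
  have hpos1 : 0 < #A1 := card_pos.2 hA1
  have hpos0 : 0 < #A0 := card_pos.2 hA0
  have i0 := ih #A0 (by omega) A0 rfl
  have i1 : #(A0 + dil A0) ≤ #(A0 + dil A) :=
    card_le_card (add_subset_add_left (image_subset_image hs0))
  have i1' : (#(A0 + dil A0) : ℝ) ≤ #(A0 + dil A) := by exact_mod_cast i1
  have hsum' : (#(A0 + dil A) : ℝ) + #(A1 + dil A) ≤ #(A + dil A) := by exact_mod_cast hsum
  have hc' : (#A0 : ℝ) + #A1 = #A := by exact_mod_cast hc
  have hp0 : (0 : ℝ) < #A0 := by exact_mod_cast hpos0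
  have hp1 : (0 : ℝ) < #A1 := by exact_mod_cast hpos1
  by_cases hsm : 6 * #A1 ≤ #A
  · have j1 : #A ≤ #(A1 + dil A) := by
      rw [← card_dil A]; exact card_le_card_add_left hA1
    have j1' : (6 : ℝ) * #A1 ≤ #(A1 + dil A) := by exact_mod_cast hsm.trans j1
    have j2 : (1 + Real.sqrt 2) ^ 2 * (#A1 : ℝ) ≤ 6 * #A1 := by gcongr
    have j3 : (#A0 : ℝ) ^ (1 - ε) ≤ (#A : ℝ) ^ (1 - ε) := by
      apply Real.rpow_le_rpow (by positivity) _ (by linarith)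
      linarith
    have j4 : (100 * C1 + 6) * (#A0 : ℝ) ^ (1 - ε) ≤ (100 * C1 + 6) * (#A : ℝ) ^ (1 - ε) := by
      gcongr
    rw [← hc'] at j4 ⊢
    linarith
  · have j1 := hkey A A1 hA1 hs1 hd (by omega)
    have j2 : (#A0 : ℝ) ≤ 5 / 6 * #A := by
      have : (#A : ℝ) ≤ 6 * #A1 := by exact_mod_cast (not_le.1 hsm).le
      linarith
    have j3 : (#A0 : ℝ) ^ (1 - ε) ≤ 99 / 100 * (#A : ℝ) ^ (1 - ε) := by
      calc (#A0 : ℝ) ^ (1 - ε) ≤ (5 / 6 * #A) ^ (1 - ε) :=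
            Real.rpow_le_rpow (by positivity) j2 (by linarith)
        _ = (5 / 6 : ℝ) ^ (1 - ε) * (#A : ℝ) ^ (1 - ε) := Real.mul_rpow (by norm_num) (by positivity)
        _ ≤ (5 / 6 : ℝ) ^ (1 / 2 : ℝ) * (#A : ℝ) ^ (1 - ε) := by
            gcongr ?_ * _
            exact Real.rpow_le_rpow_of_exponent_ge (by norm_num) (by norm_num) (by linarith)
        _ ≤ _ := by
            gcongr
            rw [← Real.sqrt_eq_rpow, Real.sqrt_le_left (by norm_num)]
            norm_num
    have j4 : (100 * C1 + 6) * (#A0 : ℝ) ^ (1 - ε) ≤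
        (100 * C1 + 6) * (99 / 100 * (#A : ℝ) ^ (1 - ε)) := by gcongr
    have j5 : 0 ≤ (#A : ℝ) ^ (1 - ε) := by positivity
    have j6 : (1 + Real.sqrt 2) ^ 2 * (#A : ℝ) =
      (1 + Real.sqrt 2) ^ 2 * (#A0 : ℝ) + (1 + Real.sqrt 2) ^ 2 * (#A1 : ℝ) := by
      rw [← hc']; ring
    nlinarith

/-- There exist absolute constants `C > 0` and `ε > 0` such that for every finite set
`A` of real numbers, `|A + √2·A| ≥ (1+√2)² |A| - C |A|^(1-ε)`. -/
theorem stmt_0 :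
    ∃ C ε : ℝ, 0 < C ∧ 0 < ε ∧
      ∀ A : Finset ℝ,
        ((Finset.image₂ (fun a b => a + Real.sqrt 2 * b) A A).card : ℝ) ≥
          (1 + Real.sqrt 2) ^ 2 * (A.card : ℝ) - C * (A.card : ℝ) ^ (1 - ε) := by
  obtain ⟨C, ε, hC, hε, -, h⟩ := main_ineq
  refine ⟨C, ε, hC, hε, fun A => ?_⟩
  have e : Finset.image₂ (fun a b => a + Real.sqrt 2 * b) A A = A + dil A := by
    ext t
    simp only [mem_image₂, mem_add, mem_dil]
    constructor
    · rintro ⟨a, ha, b, hb, rfl⟩; exact ⟨a, ha, _, ⟨b, hb, rfl⟩, rfl⟩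
    · rintro ⟨a, ha, _, ⟨b, hb, rfl⟩, rfl⟩; exact ⟨a, ha, b, hb, rfl⟩
  rw [e]
  exact h A
end

section
/- Let T : ℤ² → ℤ² be the additive map T(a,b) = (2b, a). There exist absolute constants C > 0 and ε > 0 such that for every finite set A ⊂ ℤ², |A + T(A)| ≥ (1+√2)²·|A| − C·|A|^(1−ε). -/
open scoped Pointwise

/-- k-fold sumsets grow polynomially. -/
lemma card_nsmul_le_poly {G : Type*} [AddCommGroup G] [DecidableEq G] (X : Finset G) (k : ℕ) :
    (k • X).card ≤ (k + 1) ^ X.card := by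
  have key : k • X ⊆ (Fintype.piFinset (fun _ : X => Finset.range (k + 1))).image
      (fun c => ∑ x : X, c x • (x : G)) := by
    induction k with
    | zero =>
      intro y hy
      simp only [zero_smul, Finset.mem_zero] at hy
      subst hy
      refine Finset.mem_image.2 ⟨fun _ => 0, by simp, by simp⟩
    | succ k ih =>
      intro y hy
      rw [succ_nsmul] at hy
      obtain ⟨a, ha, x, hx, rfl⟩ := Finset.mem_add.1 hy
      obtain ⟨c, hc, rfl⟩ := Finset.mem_image.1 (ih ha)
      refine Finset.mem_image.2 ⟨fun z => c z + if z = ⟨x, hx⟩ then 1 else 0, ?_, ?_⟩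
      · simp only [Fintype.mem_piFinset, Finset.mem_range] at hc ⊢
        intro z
        have := hc z
        split_ifs <;> omega
      · simp [add_smul, Finset.sum_add_distrib, ite_smul]
  calc (k • X).card ≤ _ := Finset.card_le_card key
    _ ≤ _ := Finset.card_image_le
    _ = _ := by simp

/-- An element all of whose dyadic multiples stay in `D - D`. -/
lemma exists_dyadic {G : Type*} [AddCommGroup G] [DecidableEq G] (D X : Finset G)
    (h : D + D ⊆ X + D) (j : ℕ) (hj : X.card ^ j < D.card) :
    ∃ v : G, v ≠ 0 ∧ ∀ i ≤ j, (2 ^ i : ℕ) • v ∈ D - D := by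
  have h1 : ∀ d : G, ∃ p : G × G, d ∈ D → p.1 ∈ X ∧ p.2 ∈ D ∧ p.1 + p.2 = d + d := by
    intro d
    by_cases hd : d ∈ D
    · obtain ⟨x, hx, e, he, hxe⟩ := Finset.mem_add.1 (h (Finset.add_mem_add hd hd))
      exact ⟨(x, e), fun _ => ⟨hx, he, hxe⟩⟩
    · exact ⟨(0, 0), fun h => absurd h hd⟩
  choose p hp using h1
  let s : ℕ → G → G := fun i d => (fun d => (p d).2)^[i] d
  have hs0 : ∀ d, s 0 d = d := fun d => rfl
  have hss : ∀ i d, s (i + 1) d = (p (s i d)).2 := fun i d =>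
    Function.iterate_succ_apply' _ _ _
  have hsD : ∀ i, ∀ d ∈ D, s i d ∈ D := by
    intro i
    induction i with
    | zero => intro d hd; exact hd
    | succ i ih => intro d hd; rw [hss]; exact (hp _ (ih d hd)).2.1
  obtain ⟨d, hd, e, he, hne, heq⟩ := Finset.exists_ne_map_eq_of_card_lt_of_maps_to
    (s := D) (t := Fintype.piFinset (fun _ : Fin j => X)) (f := fun d i => (p (s i d)).1)
    (by simpa using hj)
    (by
      intro d hd
      simp only [Finset.mem_coe, Fintype.mem_piFinset]
      intro i
      exact (hp _ (hsD i d hd)).1)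
  refine ⟨d - e, sub_ne_zero.2 hne, ?_⟩
  have key : ∀ i ≤ j, (2 ^ i : ℕ) • (d - e) = s i d - s i e := by
    intro i
    induction i with
    | zero => intro _; simp [hs0]
    | succ i ih =>
      intro hi
      have h2 := ih (by omega)
      have h3 := congrFun heq ⟨i, by omega⟩
      simp only at h3
      have h4 := (hp _ (hsD i d hd)).2.2
      have h5 := (hp _ (hsD i e he)).2.2
      rw [hss, hss, pow_succ, mul_comm, mul_nsmul, two_nsmul, nsmul_add, h2]
      have : (s i d + s i d) - (s i e + s i e) = (p (s i d)).2 - (p (s i e)).2 := by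
        rw [← h4, ← h5, h3]; abel
      rw [← this]; abel
  intro i hi
  rw [key i hi]
  exact Finset.sub_mem_sub (hsD i d hd) (hsD i e he)

lemma mul_mem_nsmul {G : Type*} [AddCommGroup G] [DecidableEq G] (E : Finset G) (v : G)
    (h0 : (0 : G) ∈ E) (j : ℕ) (h : ∀ i ≤ j, (2 ^ i : ℕ) • v ∈ E) :
    ∀ n < 2 ^ j, n • v ∈ j • E := by
  induction j with
  | zero => intro n hn; simp at hn; subst hn; simp
  | succ j ih =>
    intro n hn
    have ih' := ih (fun i hi => h i (by omega))
    rw [succ_nsmul]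
    by_cases hnj : n < 2 ^ j
    · have := Finset.add_mem_add (ih' n hnj) h0
      simpa using this
    · have := Finset.add_mem_add (ih' (n - 2 ^ j) (by rw [pow_succ] at hn; omega)) (h j (by omega))
      rwa [← add_nsmul, Nat.sub_add_cancel (by omega)] at this

lemma add_nsmul_subset {G : Type*} [AddCommGroup G] [DecidableEq G] (D X : Finset G)
    (h : D + D ⊆ X + D) (k : ℕ) : D + k • D ⊆ k • X + D := by
  induction k with
  | zero => simp
  | succ k ih =>
    calc D + (k + 1) • D = (D + k • D) + D := by rw [succ_nsmul, add_assoc]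
      _ ⊆ (k • X + D) + D := Finset.add_subset_add_right ih
      _ = k • X + (D + D) := by rw [add_assoc]
      _ ⊆ k • X + (X + D) := Finset.add_subset_add_left h
      _ = (k + 1) • X + D := by rw [succ_nsmul, add_assoc]

lemma fibers_mul_le {G : Type*} [AddCommGroup G] [DecidableEq G] [IsAddTorsionFree G]
    (S : Finset G) (p : G →+ ℤ) (v : G) (hv : v ≠ 0) (hpv : p v = 0) (m : ℕ) :
    (S.image p).card * m ≤ (S + (Finset.range m).image (fun n => n • v)).card := by
  have h1 : ∀ t : ℤ, ∃ a : G, t ∈ S.image p → a ∈ S ∧ p a = t := by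
    intro t
    by_cases ht : t ∈ S.image p
    · obtain ⟨a, ha, h⟩ := Finset.mem_image.1 ht
      exact ⟨a, fun _ => ⟨ha, h⟩⟩
    · exact ⟨0, fun h => absurd h ht⟩
  choose r hr using h1
  calc (S.image p).card * m = ((S.image p) ×ˢ (Finset.range m)).card := by simp
    _ ≤ _ := by
      refine Finset.card_le_card_of_injOn (fun q => r q.1 + q.2 • v) ?_ ?_
      · rintro ⟨t, n⟩ hq
        simp only [Finset.coe_product, Set.mem_prod, Finset.mem_coe] at hq
        exact Finset.add_mem_add (hr t hq.1).1 (Finset.mem_image_of_mem _ hq.2)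
      · rintro ⟨t, n⟩ hq ⟨t', n'⟩ hq' heq
        simp only [Finset.coe_product, Set.mem_prod, Finset.mem_coe] at hq hq'
        simp only at heq
        have h2 := congrArg p heq
        simp only [map_add, map_nsmul, hpv, smul_zero, add_zero] at h2
        rw [(hr t hq.1).2, (hr t' hq'.1).2] at h2
        subst h2
        have h3 := add_left_cancel heq
        have : n = n' := 
          IsAddLeftRegular.nsmul_injective (IsAddLeftRegular.all v) hv h3
        simp [this]

lemma level_sets (X Y : Finset (ℤ × ℤ)) (hX : X.Nonempty) (hY : Y.Nonempty) (p : ℤ × ℤ →+ ℤ) :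
    ∃ M N : ℕ, 0 < M ∧ 0 < N ∧ (∃ r, M = (X.filter (fun x => p x = r)).card) ∧
      (∃ r, N = (Y.filter (fun x => p x = r)).card) ∧
      (M + N) * (N * X.card + M * Y.card) ≤
        M * N * ((X + Y).card + ((X + Y).image p).card) + M * N * (M + N) := by
  classical
  set f : ℤ → ℕ := fun r => (X.filter (fun x => p x = r)).card with hf
  set g : ℤ → ℕ := fun r => (Y.filter (fun x => p x = r)).card with hg
  set h : ℤ → ℕ := fun r => ((X + Y).filter (fun x => p x = r)).card with hh
  set P := X.image p
  set Q := Y.image p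
  set R := (X + Y).image p
  have hP : P.Nonempty := hX.image _
  have hQ : Q.Nonempty := hY.image _
  obtain ⟨r0, hr0, hM⟩ := Finset.exists_max_image P f hP
  obtain ⟨s0, hs0, hN⟩ := Finset.exists_max_image Q g hQ
  have hfpos : ∀ r ∈ P, 0 < f r := by
    intro r hr
    obtain ⟨x, hx, rfl⟩ := Finset.mem_image.1 hr
    exact Finset.card_pos.2 ⟨x, by simp [hx]⟩
  have hgpos : ∀ r ∈ Q, 0 < g r := by
    intro r hr
    obtain ⟨x, hx, rfl⟩ := Finset.mem_image.1 hr
    exact Finset.card_pos.2 ⟨x, by simp [hx]⟩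
  have hfg : ∀ r ∈ P, ∀ s ∈ Q, f r + g s ≤ h (r + s) + 1 := by
    intro r hr s hs
    have h1 := cauchy_davenport_of_isAddTorsionFree (s := X.filter (fun x => p x = r))
      (t := Y.filter (fun x => p x = s)) (Finset.card_pos.1 (hfpos r hr))
      (Finset.card_pos.1 (hgpos s hs))
    have h2 : X.filter (fun x => p x = r) + Y.filter (fun x => p x = s) ⊆
        (X + Y).filter (fun x => p x = r + s) := by
      intro z hz
      obtain ⟨a, ha, b, hb, rfl⟩ := Finset.mem_add.1 hz
      simp only [Finset.mem_filter] at ha hb ⊢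
      exact ⟨Finset.add_mem_add ha.1 hb.1, by rw [map_add, ha.2, hb.2]⟩
    have h3 := Finset.card_le_card h2
    simp only [hf, hg, hh]
    omega
  have hsf : ∑ r ∈ P, f r = X.card :=
    (Finset.card_eq_sum_card_image p X).symm
  have hsg : ∑ r ∈ Q, g r = Y.card :=
    (Finset.card_eq_sum_card_image p Y).symm
  have hsh : ∑ r ∈ R, h r = (X + Y).card :=
    (Finset.card_eq_sum_card_image p (X + Y)).symm
  have hMpos := hfpos r0 hr0
  have hNpos := hgpos s0 hs0
  refine ⟨f r0, g s0, hMpos, hNpos, ⟨r0, rfl⟩, ⟨s0, rfl⟩, ?_⟩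
  obtain ⟨M, hMd⟩ : ∃ M, f r0 = M := ⟨_, rfl⟩
  obtain ⟨N, hNd⟩ : ∃ N, g s0 = N := ⟨_, rfl⟩
  rw [hMd, hNd]
  rw [hMd] at hM hMpos
  rw [hNd] at hN hNpos
  set I := Finset.Icc 1 (M * N) with hI
  have hstep : ∀ k ∈ I, (P.filter (fun r => k ≤ N * f r)).card +
      (Q.filter (fun s => k ≤ M * g s)).card ≤
      (R.filter (fun t => k * (M + N) ≤ M * N * (h t + 1))).card + 1 := by
    intro k hk
    rw [hI, Finset.mem_Icc] at hk
    have hn1 : (P.filter (fun r => k ≤ N * f r)).Nonempty :=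
      ⟨r0, by rw [Finset.mem_filter, hMd]; exact ⟨hr0, by rw [mul_comm]; exact hk.2⟩⟩
    have hn2 : (Q.filter (fun s => k ≤ M * g s)).Nonempty :=
      ⟨s0, by rw [Finset.mem_filter, hNd]; exact ⟨hs0, hk.2⟩⟩
    have h1 := cauchy_davenport_of_isAddTorsionFree hn1 hn2
    have h2 : P.filter (fun r => k ≤ N * f r) + Q.filter (fun s => k ≤ M * g s) ⊆
        R.filter (fun t => k * (M + N) ≤ M * N * (h t + 1)) := by
      intro z hz
      obtain ⟨r, hr, s, hs, rfl⟩ := Finset.mem_add.1 hz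
      simp only [Finset.mem_filter] at hr hs ⊢
      refine ⟨?_, ?_⟩
      · obtain ⟨x, hx, rfl⟩ := Finset.mem_image.1 hr.1
        obtain ⟨y, hy, rfl⟩ := Finset.mem_image.1 hs.1
        exact Finset.mem_image.2 ⟨x + y, Finset.add_mem_add hx hy, map_add _ _ _⟩
      · calc k * (M + N) = M * k + N * k := by ring
          _ ≤ M * (N * f r) + N * (M * g s) := by gcongr <;> simp [hr.2, hs.2]
          _ = M * N * (f r + g s) := by ring
          _ ≤ _ := Nat.mul_le_mul_left _ (hfg r hr.1 s hs.1)
    have h3 := Finset.card_le_card h2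
    omega
  have hA : ∑ k ∈ I, (P.filter (fun r => k ≤ N * f r)).card = N * X.card := by
    rw [← hsf, Finset.mul_sum]
    refine (Finset.sum_card_bipartiteAbove_eq_sum_card_bipartiteBelow
      (fun k r => k ≤ N * f r)).trans (Finset.sum_congr rfl fun r hr => ?_)
    have : Finset.bipartiteBelow (fun k r => k ≤ N * f r) I r = Finset.Icc 1 (N * f r) := by
      ext k
      have : N * f r ≤ M * N := by rw [mul_comm M]; exact Nat.mul_le_mul_left _ (hM r hr)
      simp only [Finset.mem_bipartiteBelow, hI, Finset.mem_Icc]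
      omega
    rw [this]; simp
  have hB : ∑ k ∈ I, (Q.filter (fun s => k ≤ M * g s)).card = M * Y.card := by
    rw [← hsg, Finset.mul_sum]
    refine (Finset.sum_card_bipartiteAbove_eq_sum_card_bipartiteBelow
      (fun k r => k ≤ M * g r)).trans (Finset.sum_congr rfl fun r hr => ?_)
    have : Finset.bipartiteBelow (fun k r => k ≤ M * g r) I r = Finset.Icc 1 (M * g r) := by
      ext k
      have : M * g r ≤ M * N := Nat.mul_le_mul_left _ (hN r hr)
      simp only [Finset.mem_bipartiteBelow, hI, Finset.mem_Icc]
      omega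
    rw [this]; simp
  have hC : (M + N) * ∑ k ∈ I, (R.filter (fun t => k * (M + N) ≤ M * N * (h t + 1))).card ≤
      M * N * ((X + Y).card + R.card) := by
    rw [← hsh, Finset.card_eq_sum_ones R, ← Finset.sum_add_distrib]
    rw [show ∑ k ∈ I, (R.filter (fun t => k * (M + N) ≤ M * N * (h t + 1))).card = _ from
      Finset.sum_card_bipartiteAbove_eq_sum_card_bipartiteBelow
      (fun k t => k * (M + N) ≤ M * N * (h t + 1)), Finset.mul_sum, Finset.mul_sum]
    refine Finset.sum_le_sum fun t ht => ?_
    have : Finset.bipartiteBelow (fun k t => k * (M + N) ≤ M * N * (h t + 1)) I t ⊆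
        Finset.Icc 1 (M * N * (h t + 1) / (M + N)) := by
      intro k hk
      simp only [Finset.mem_bipartiteBelow, hI, Finset.mem_Icc] at hk ⊢
      exact ⟨hk.1.1, (Nat.le_div_iff_mul_le (by omega)).2 hk.2⟩
    have h1 := Finset.card_le_card this
    rw [Nat.card_Icc, Nat.add_sub_cancel] at h1
    calc _ ≤ (M + N) * (M * N * (h t + 1) / (M + N)) := Nat.mul_le_mul_left _ h1
      _ ≤ _ := Nat.mul_div_le _ _
  have hS := Finset.sum_le_sum hstep
  rw [Finset.sum_add_distrib, Finset.sum_add_distrib, hA, hB] at hS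
  simp only [Finset.sum_const, smul_eq_mul, mul_one] at hS
  have hIc : I.card = M * N := by simp [hI]
  rw [hIc] at hS
  calc _ ≤ (M + N) * (_ + M * N) := Nat.mul_le_mul_left _ hS
    _ = (M + N) * ∑ k ∈ I, (R.filter (fun t => k * (M + N) ≤ M * N * (h t + 1))).card
        + M * N * (M + N) := by ring
    _ ≤ _ := Nat.add_le_add_right hC _

/-- Multiplication by `√2` on `ℤ[√2] = ℤ²`. -/
def sqT : ℤ × ℤ →+ ℤ × ℤ where
  toFun b := (2 * b.2, b.1)
  map_zero' := by simp
  map_add' a b := by ext <;> simp [mul_add]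

/-- The linear form with kernel the line spanned by `v`. -/
def detv (v : ℤ × ℤ) : ℤ × ℤ →+ ℤ where
  toFun x := v.1 * x.2 - v.2 * x.1
  map_zero' := by simp
  map_add' a b := by simp; ring

lemma sqT_apply (b : ℤ × ℤ) : sqT b = (2 * b.2, b.1) := rfl
lemma detv_apply (v x : ℤ × ℤ) : detv v x = v.1 * x.2 - v.2 * x.1 := rfl

lemma sqT_injective : Function.Injective sqT := by
  intro a b h
  simp only [sqT_apply, Prod.mk.injEq] at h
  ext <;> omega

lemma sq_two_aux (a b : ℤ) (h : a * a = 2 * (b * b)) : a = 0 ∧ b = 0 := by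
  have h2 : (2 : ℕ).Prime := Nat.prime_two
  by_cases hb : b = 0
  · subst hb; simp at h; exact ⟨h, rfl⟩
  · exfalso
    have hirr : Irrational (Real.sqrt 2) := irrational_sqrt_two
    apply hirr
    refine ⟨|(a : ℚ) / b|, ?_⟩
    have hb' : (b : ℝ) ≠ 0 := by exact_mod_cast hb
    have hr : (a : ℝ) * a = 2 * (b * b) := by exact_mod_cast h
    push_cast
    rw [eq_comm, Real.sqrt_eq_iff_mul_self_eq (by norm_num) (abs_nonneg _), abs_mul_abs_self]
    field_simp
    linarith

lemma detv_ker (v w : ℤ × ℤ) (hv : v ≠ 0) (h1 : detv v w = 0) (h2 : detv v (sqT w) = 0) :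
    w = 0 := by
  simp only [detv_apply, sqT_apply] at h1 h2
  obtain ⟨a, b⟩ := w
  obtain ⟨x, y⟩ := v
  simp only at h1 h2
  by_cases hx : x = 0
  · subst hx
    have hy : y ≠ 0 := by rintro rfl; exact hv rfl
    have ha : a = 0 := by simpa [hy] using h1
    have hb : b = 0 := by simpa [hy] using h2
    simp [ha, hb]
  · have : x * (a * a - 2 * (b * b)) = 0 := by linear_combination a * h2 - 2 * b * h1
    have h3 := (mul_eq_zero.1 this).resolve_left hx
    obtain ⟨rfl, rfl⟩ := sq_two_aux a b (by linarith)
    rfl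

lemma structure_lemma (A : Finset (ℤ × ℤ)) (hA : A.Nonempty)
    (h6 : (A + A.image sqT).card ≤ 6 * A.card) (K : ℕ) (hK : K = 6 ^ 5) (j : ℕ)
    (hj : K ^ j < A.card) :
    ∃ v : ℤ × ℤ, v ≠ 0 ∧
      ((A + A.image sqT).image (detv v)).card * 2 ^ j ≤
        1296 * (2 * j + 1) ^ K * A.card := by
  have hTA : (A.image sqT).card = A.card := Finset.card_image_of_injective _ sqT_injective
  have hpos : 0 < A.card := hA.card_pos
  have hpl : ∀ m n : ℕ, (m • A - n • A).card ≤ 6 ^ (m + n) * A.card := by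
    intro m n
    have h1 := Finset.pluennecke_ruzsa_inequality_nsmul_sub_nsmul_add (A := A.image sqT)
      (hA.image _) A m n
    rw [hTA, add_comm (A.image sqT) A] at h1
    have h2 : ((A + A.image sqT).card : ℚ≥0) / A.card ≤ 6 := by
      rw [div_le_iff₀ (by exact_mod_cast hpos)]
      exact_mod_cast h6
    have h3 : ((m • A - n • A).card : ℚ≥0) ≤ 6 ^ (m + n) * A.card := by
      refine h1.trans ?_
      gcongr
    exact_mod_cast h3
  set D := A - A with hD
  have h0D : (0 : ℤ × ℤ) ∈ D := hA.zero_mem_sub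
  have hDD : D - D = D + D := by
    rw [sub_eq_add_neg, hD, neg_sub]
  have hDA : D + D + A = 3 • A - 2 • A := by
    rw [hD, sub_add_sub_comm, sub_add_eq_add_sub, succ_nsmul, two_nsmul]
  have hAD : A + D = 2 • A - 1 • A := by
    rw [hD, one_nsmul, two_nsmul, add_sub_assoc]
  obtain ⟨X, -, hX, hDX⟩ := Finset.ruzsa_covering_add (A := D + D) (B := A) (K := (K : ℝ)) hA (by
    rw [hDA, hK]; exact_mod_cast hpl 3 2)
  rw [← hD] at hDX
  have hX' : X.card ≤ K := by exact_mod_cast hX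
  obtain ⟨Y, -, hY, hTY⟩ := Finset.ruzsa_covering_add (A := A.image sqT) (B := A) (K := 6) hA (by
    rw [add_comm]; exact_mod_cast h6)
  rw [← hD] at hTY
  have hY' : Y.card ≤ 6 := by exact_mod_cast hY
  have hAleD : A.card ≤ D.card := Finset.card_le_card_sub_right hA
  obtain ⟨v, hv, hvD⟩ := exists_dyadic D X hDX j
    (lt_of_le_of_lt (Nat.pow_le_pow_left hX' j) (lt_of_lt_of_le hj hAleD))
  rw [hDD] at hvD
  have hP := mul_mem_nsmul (D + D) v (by simpa using Finset.add_mem_add h0D h0D) j hvD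
  refine ⟨v, hv, ?_⟩
  have hf := fibers_mul_le (A + A.image sqT) (detv v) v hv (by rw [detv_apply]; ring) (2 ^ j)
  refine hf.trans ?_
  have hsub : A + A.image sqT + (Finset.range (2 ^ j)).image (fun n => n • v) ⊆
      Y + (2 * j) • X + (2 • A - 1 • A) := by
    calc A + A.image sqT + (Finset.range (2 ^ j)).image (fun n => n • v)
        ⊆ A + (Y + D) + j • (D + D) := by
          refine Finset.add_subset_add (Finset.add_subset_add_left hTY) ?_
          intro z hz
          obtain ⟨n, hn, rfl⟩ := Finset.mem_image.1 hz
          exact hP n (Finset.mem_range.1 hn)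
      _ = (Y + A) + (D + (2 * j) • D) := by
          rw [← two_nsmul, ← mul_nsmul, ← add_assoc, ← add_assoc, add_comm A Y]
      _ ⊆ (Y + A) + ((2 * j) • X + D) :=
          Finset.add_subset_add_left (add_nsmul_subset D X hDX (2 * j))
      _ = Y + (2 * j) • X + (2 • A - 1 • A) := by rw [← hAD, add_add_add_comm]
  calc _ ≤ _ := Finset.card_le_card hsub
    _ ≤ Y.card * ((2 * j) • X).card * (2 • A - 1 • A).card :=
      Finset.card_add_le.trans (Nat.mul_le_mul_right _ Finset.card_add_le)
    _ ≤ 6 * (2 * j + 1) ^ K * (6 ^ (2 + 1) * A.card) := by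
      refine Nat.mul_le_mul (Nat.mul_le_mul hY' ((card_nsmul_le_poly X (2 * j)).trans ?_)) (hpl 2 1)
      exact Nat.pow_le_pow_right (by omega) hX'
    _ = _ := by ring

/-- A line meets `A` in at most `√|A + TA|` points. -/
lemma line_bound (A S : Finset (ℤ × ℤ)) (v : ℤ × ℤ) (hv : v ≠ 0) (hSA : S ⊆ A)
    (r : ℤ) (hS : (∀ x ∈ S, detv v x = r) ∨ (∀ x ∈ S, detv v (sqT x) = r)) :
    S.card * S.card ≤ (A + A.image sqT).card := by
  have h1 : (S + S.image sqT).card = S.card * (S.image sqT).card := by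
    rw [Finset.card_add_iff]
    rintro ⟨a, b⟩ ha ⟨c, d⟩ hc heq
    simp only [Set.mem_prod, Finset.coe_image, Set.mem_image, Finset.mem_coe] at ha hc heq
    obtain ⟨ha, b', hb, rfl⟩ := ha
    obtain ⟨hc, d', hd, rfl⟩ := hc
    have hac : a - c = sqT (d' - b') := by
      rw [map_sub, sub_eq_sub_iff_add_eq_add, heq, add_comm]
    rcases hS with hS | hS
    · have : d' - b' = 0 := by
        apply detv_ker v _ hv
        · rw [map_sub, hS _ hd, hS _ hb, sub_self]
        · rw [← hac, map_sub, hS _ ha, hS _ hc, sub_self]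
      rw [this, map_zero, sub_eq_zero] at hac
      rw [sub_eq_zero] at this
      rw [hac, this]
    · have : a - c = 0 := by
        apply detv_ker v _ hv
        · rw [hac, map_sub, map_sub, hS _ hd, hS _ hb, sub_self]
        · rw [map_sub, map_sub, hS _ ha, hS _ hc, sub_self]
      have hdb : d' - b' = 0 := by
        apply sqT_injective
        rw [← hac, this, map_zero]
      rw [sub_eq_zero] at this hdb
      rw [this, hdb]
  rw [Finset.card_image_of_injective _ sqT_injective] at h1
  rw [← h1]
  exact Finset.card_le_card (Finset.add_subset_add hSA (Finset.image_subset_image hSA))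

lemma poly_le_exp (K : ℕ) : ∃ C : ℝ, 0 < C ∧ ∀ j : ℕ, ((2 * j + 1 : ℕ) : ℝ) ^ K ≤ C * (Real.sqrt 2) ^ j := by
  have h := tendsto_pow_const_div_const_pow_of_one_lt K
    (show (1 : ℝ) < Real.sqrt 2 by rw [Real.lt_sqrt] <;> norm_num)
  obtain ⟨B, hB⟩ := h.bddAbove_range
  refine ⟨(max B 1) * 3 ^ K + 1, by positivity, fun j => ?_⟩
  have hpos : 0 < (Real.sqrt 2) ^ j := by positivity
  rcases Nat.eq_zero_or_pos j with rfl | hj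
  · simp
  have h1 : (j : ℝ) ^ K / (Real.sqrt 2) ^ j ≤ B := hB ⟨j, rfl⟩
  rw [div_le_iff₀ hpos] at h1
  have h3 : ((2 * j + 1 : ℕ) : ℝ) ≤ 3 * j := by exact_mod_cast (by omega)
  calc ((2 * j + 1 : ℕ) : ℝ) ^ K ≤ (3 * j) ^ K := by gcongr
    _ = 3 ^ K * j ^ K := mul_pow _ _ _
    _ ≤ 3 ^ K * (B * (Real.sqrt 2) ^ j) := by gcongr
    _ ≤ 3 ^ K * (max B 1 * (Real.sqrt 2) ^ j) := by gcongr; exact le_max_left _ _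
    _ ≤ (max B 1 * 3 ^ K + 1) * (Real.sqrt 2) ^ j := by nlinarith

lemma bm_lemma : ∃ C : ℝ, 1 ≤ C ∧ ∀ A B : Finset (ℤ × ℤ), 2 ≤ A.card →
    (A + A.image sqT).card ≤ 6 * A.card → B ⊆ A → B.Nonempty →
    (B.card : ℝ) + A.card + 2 * (Real.sqrt B.card * Real.sqrt A.card) -
      C * (A.card : ℝ) ^ (1 - 1 / 26 : ℝ) ≤ (B + A.image sqT).card := by
  obtain ⟨K, hK⟩ : ∃ K : ℕ, K = 6 ^ 5 := ⟨_, rfl⟩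
  obtain ⟨C0, hC0, hpoly⟩ := poly_le_exp K
  refine ⟨2592 * C0 + 6, by linarith, ?_⟩
  intro A B hA2 h6 hBA hB
  have hA : A.Nonempty := Finset.card_pos.1 (by omega)
  have hK1 : 1 < K := by rw [hK]; norm_num
  have hK13 : K ≤ 2 ^ 13 := by rw [hK]; norm_num
  have hTA : (A.image sqT).card = A.card := Finset.card_image_of_injective _ sqT_injective
  obtain ⟨j, hj1, hj2⟩ : ∃ j, K ^ j < A.card ∧ A.card ≤ K ^ (j + 1) := by
    have h0 : 0 < Nat.clog K A.card := Nat.clog_pos hK1 hA2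
    refine ⟨Nat.clog K A.card - 1, Nat.pow_pred_clog_lt_self hK1 hA2, ?_⟩
    rw [Nat.sub_add_cancel h0]
    exact Nat.le_pow_clog hK1 _
  obtain ⟨v, hv, hL⟩ := structure_lemma A hA h6 K hK j hj1
  obtain ⟨M, N, hM, hN, ⟨r, hMr⟩, ⟨s, hNs⟩, hlev⟩ :=
    level_sets B (A.image sqT) hB (hA.image _) (detv v)
  rw [hTA] at hlev
  have hLle : ((B + A.image sqT).image (detv v)).card ≤
      ((A + A.image sqT).image (detv v)).card :=
    Finset.card_le_card (Finset.image_subset_image (Finset.add_subset_add_right hBA))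
  have hMM : M * M ≤ 6 * A.card := by
    refine le_trans ?_ h6
    rw [hMr]
    refine line_bound A _ v hv ((Finset.filter_subset _ _).trans hBA) r (Or.inl ?_)
    intro x hx
    exact (Finset.mem_filter.1 hx).2
  have hNN : N * N ≤ 6 * A.card := by
    refine le_trans ?_ h6
    have : N = (A.filter (fun x => detv v (sqT x) = s)).card := by
      rw [hNs, Finset.filter_image, Finset.card_image_of_injective _ sqT_injective]
    rw [this]
    refine line_bound A _ v hv (Finset.filter_subset _ _) s (Or.inr ?_)
    intro x hx
    exact (Finset.mem_filter.1 hx).2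
  generalize ((A + A.image sqT).image (detv v)).card = L at *
  generalize ((B + A.image sqT).image (detv v)).card = L' at *
  generalize (B + A.image sqT).card = S at *
  have hn1 : (1 : ℝ) ≤ A.card := by exact_mod_cast (by omega : 1 ≤ A.card)
  generalize A.card = n at *
  generalize B.card = b at *
  have hn0 : (0 : ℝ) < n := by linarith
  -- square root bound
  have hsq : Real.sqrt n ≤ (n : ℝ) ^ (1 - 1 / 26 : ℝ) := by
    rw [Real.sqrt_eq_rpow]
    exact Real.rpow_le_rpow_of_exponent_le hn1 (by norm_num)
  have hsn : Real.sqrt n * Real.sqrt n = n := Real.mul_self_sqrt hn0.le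
  have hsn0 : 0 ≤ Real.sqrt n := Real.sqrt_nonneg _
  have hsb : Real.sqrt b * Real.sqrt b = b := Real.mul_self_sqrt (by positivity)
  have hM3 : (M : ℝ) ≤ 3 * Real.sqrt n := by
    have : (M : ℝ) * M ≤ 6 * n := by exact_mod_cast hMM
    apply abs_le_of_sq_le_sq' _ (by positivity) |>.2
    nlinarith
  have hN3 : (N : ℝ) ≤ 3 * Real.sqrt n := by
    have : (N : ℝ) * N ≤ 6 * n := by exact_mod_cast hNN
    apply abs_le_of_sq_le_sq' _ (by positivity) |>.2
    nlinarith
  -- number of lines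
  have hLb : (L : ℝ) ≤ 2592 * C0 * (n : ℝ) ^ (1 - 1 / 26 : ℝ) := by
    have hq : Real.sqrt 2 * Real.sqrt 2 = 2 := Real.mul_self_sqrt (by norm_num)
    have hq2 : Real.sqrt 2 ≤ 2 := by nlinarith [Real.sqrt_nonneg 2]
    have hqp : 0 < Real.sqrt 2 ^ j := by positivity
    have h1 : (L : ℝ) * 2 ^ j ≤ 1296 * ((2 * j + 1 : ℕ) : ℝ) ^ K * n := by exact_mod_cast hL
    have h2 : (L : ℝ) * (Real.sqrt 2 ^ j * Real.sqrt 2 ^ j) ≤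
        1296 * (C0 * Real.sqrt 2 ^ j) * n := by
      rw [← mul_pow, hq]
      refine h1.trans ?_
      gcongr
      exact hpoly j
    have h3 : (L : ℝ) * Real.sqrt 2 ^ j ≤ 1296 * C0 * n := by
      refine le_of_mul_le_mul_right ?_ hqp
      nlinarith
    have h4 : (n : ℝ) ^ (1 / 26 : ℝ) ≤ Real.sqrt 2 ^ (j + 1) := by
      have h5 : (n : ℝ) ≤ (Real.sqrt 2 ^ (j + 1)) ^ 26 := by
        have : (n : ℝ) ≤ (2 ^ 13) ^ (j + 1) := by
          exact_mod_cast hj2.trans (Nat.pow_le_pow_left hK13 _)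
        refine this.trans (le_of_eq ?_)
        rw [← pow_mul (Real.sqrt 2), mul_comm (j + 1) 26, pow_mul (Real.sqrt 2)]
        congr 1
        rw [show (26 : ℕ) = 2 * 13 by norm_num, pow_mul, Real.sq_sqrt (by norm_num)]
      calc (n : ℝ) ^ (1 / 26 : ℝ) ≤ ((Real.sqrt 2 ^ (j + 1)) ^ 26) ^ (1 / 26 : ℝ) := by
            gcongr
        _ = _ := by
            rw [← Real.rpow_natCast, ← Real.rpow_mul (by positivity)]
            norm_num
    have h6 : (n : ℝ) ^ (1 - 1 / 26 : ℝ) * (n : ℝ) ^ (1 / 26 : ℝ) = n := by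
      rw [← Real.rpow_add hn0]; norm_num
    have hp : 0 < (n : ℝ) ^ (1 / 26 : ℝ) := by positivity
    refine le_of_mul_le_mul_right ?_ hp
    calc (L : ℝ) * (n : ℝ) ^ (1 / 26 : ℝ) ≤ L * Real.sqrt 2 ^ (j + 1) := by gcongr
      _ = (L * Real.sqrt 2 ^ j) * Real.sqrt 2 := by ring
      _ ≤ (1296 * C0 * n) * 2 := by gcongr
      _ = 2592 * C0 * n := by ring
      _ = _ := by rw [mul_assoc (2592 * C0), h6]
  have hL'L : (L' : ℝ) ≤ L := by exact_mod_cast hLle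
  have hM0 : (0 : ℝ) < M := by exact_mod_cast hM
  have hN0 : (0 : ℝ) < N := by exact_mod_cast hN
  have hlev' : ((M : ℝ) + N) * (N * b + M * n) ≤ M * N * (S + L') + M * N * (M + N) := by
    exact_mod_cast hlev
  have hkey : (b : ℝ) + n + 2 * (Real.sqrt b * Real.sqrt n) ≤ S + L' + (M + N) := by
    have hMN : (0 : ℝ) < M * N := by positivity
    refine le_of_mul_le_mul_left ?_ hMN
    have h0 := sq_nonneg ((N : ℝ) * Real.sqrt b - M * Real.sqrt n)
    have h1 : ((N : ℝ) * Real.sqrt b - M * Real.sqrt n) ^ 2 =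
      N * N * b + M * M * n - 2 * (M * N * (Real.sqrt b * Real.sqrt n)) := by
      rw [← hsn, ← hsb]
      simp only [Real.sqrt_mul_self hsn0, Real.sqrt_mul_self (Real.sqrt_nonneg _)]
      ring
    rw [h1] at h0
    nlinarith
  linarith

lemma sumset_card_affine (B : Finset (ℤ × ℤ)) (c : ℤ × ℤ) :
    ((B.image (fun x => sqT x + c)) + (B.image (fun x => sqT x + c)).image sqT).card =
      (B + B.image sqT).card := by
  have : (B.image (fun x => sqT x + c)) + (B.image (fun x => sqT x + c)).image sqT =
      (B + B.image sqT).image (fun z => sqT z + (c + sqT c)) := by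
    ext z
    simp only [Finset.mem_add, Finset.mem_image]
    constructor
    · rintro ⟨_, ⟨x, hx, rfl⟩, _, ⟨_, ⟨y, hy, rfl⟩, rfl⟩, rfl⟩
      exact ⟨x + sqT y, ⟨x, hx, _, ⟨y, hy, rfl⟩, rfl⟩, by simp only [map_add]; abel⟩
    · rintro ⟨_, ⟨x, hx, _, ⟨y, hy, rfl⟩, rfl⟩, rfl⟩
      exact ⟨_, ⟨x, hx, rfl⟩, _, ⟨_, ⟨y, hy, rfl⟩, rfl⟩, by simp only [map_add]; abel⟩
  rw [this]
  apply Finset.card_image_of_injective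
  intro x y h
  exact sqT_injective (add_right_cancel h)

lemma reduce_aux (m : ℕ) : ∀ (A : Finset (ℤ × ℤ)) (a b : ℤ × ℤ), a ∈ A → b ∈ A → a ≠ b →
    4 * (a.1 - b.1).natAbs + 6 * (a.2 - b.2).natAbs ≤ m →
    ∃ B : Finset (ℤ × ℤ), B.card = A.card ∧
      (B + B.image sqT).card = (A + A.image sqT).card ∧
      (∃ x ∈ B, x.1 % 2 = 0) ∧ (∃ x ∈ B, x.1 % 2 = 1) := by
  induction m with
  | zero =>
    intro A a b ha hb hab h
    exfalso
    apply hab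
    ext <;> omega
  | succ m ih =>
    intro A a b ha hb hab h
    by_cases hgood : (∃ x ∈ A, x.1 % 2 = 0) ∧ (∃ x ∈ A, x.1 % 2 = 1)
    · exact ⟨A, rfl, rfl, hgood⟩
    have hsame : ∀ x ∈ A, x.1 % 2 = a.1 % 2 := by
      intro x hx
      by_contra hne
      apply hgood
      rcases Int.emod_two_eq_zero_or_one x.1 with h0 | h0 <;>
      rcases Int.emod_two_eq_zero_or_one a.1 with h1 | h1
      · omega
      · exact ⟨⟨x, hx, h0⟩, ⟨a, ha, h1⟩⟩
      · exact ⟨⟨a, ha, h1⟩, ⟨x, hx, h0⟩⟩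
      · omega
    set A' := A.image (fun x : ℤ × ℤ => (x.2, x.1 / 2)) with hA'
    have hAA : A'.image (fun x => sqT x + (a.1 % 2, 0)) = A := by
      rw [hA', Finset.image_image]
      refine (Finset.image_congr (g := id) ?_).trans Finset.image_id
      intro x hx
      have := hsame x hx
      ext
      · simp only [Function.comp, sqT_apply, Prod.fst_add, id]; omega
      · simp [sqT_apply]
    have hinj : Function.Injective (fun x : ℤ × ℤ => sqT x + (a.1 % 2, 0)) := by
      intro x y h
      exact sqT_injective (add_right_cancel h)
    have hcard : A'.card = A.card := by
      conv_rhs => rw [← hAA]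
      rw [Finset.card_image_of_injective _ hinj]
    have hsum := sumset_card_affine A' (a.1 % 2, 0)
    rw [hAA] at hsum
    have hab2 := hsame b hb
    have hne : ¬ (a.1 = b.1 ∧ a.2 = b.2) := fun h => hab (Prod.ext h.1 h.2)
    obtain ⟨B, h1, h2, h3⟩ := ih A' (a.2, a.1 / 2) (b.2, b.1 / 2)
      (Finset.mem_image_of_mem (fun x : ℤ × ℤ => (x.2, x.1 / 2)) ha)
      (Finset.mem_image_of_mem (fun x : ℤ × ℤ => (x.2, x.1 / 2)) hb)
      (by
        intro h
        simp only [Prod.mk.injEq] at h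
        apply hne
        omega)
      (by
        simp only
        omega)
    exact ⟨B, h1.trans hcard, h2.trans hsum.symm, h3⟩

lemma reduce_lemma (A : Finset (ℤ × ℤ)) (hA : 2 ≤ A.card) :
    ∃ B : Finset (ℤ × ℤ), B.card = A.card ∧
      (B + B.image sqT).card = (A + A.image sqT).card ∧
      (∃ x ∈ B, x.1 % 2 = 0) ∧ (∃ x ∈ B, x.1 % 2 = 1) := by
  obtain ⟨a, ha, b, hb, hab⟩ := Finset.one_lt_card.1 (show 1 < A.card by omega)
  refine reduce_aux _ A a b ha hb hab le_rfl

/-- Splitting along the two cosets of `T ℤ²`. -/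
lemma split_lemma (A : Finset (ℤ × ℤ)) (h0 : ∃ x ∈ A, x.1 % 2 = 0) (h1 : ∃ x ∈ A, x.1 % 2 = 1) :
    ∃ P Q : Finset (ℤ × ℤ), P ⊆ A ∧ Q ⊆ A ∧ Q.Nonempty ∧ P.card + Q.card = A.card ∧
      2 * Q.card ≤ A.card ∧
      (P + P.image sqT).card + (Q + A.image sqT).card ≤ (A + A.image sqT).card := by
  have key : ∀ P Q : Finset (ℤ × ℤ), P ⊆ A → Q ⊆ A →
      (∀ x ∈ P, ∀ y ∈ Q, x.1 % 2 ≠ y.1 % 2) →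
      (P + P.image sqT).card + (Q + A.image sqT).card ≤ (A + A.image sqT).card := by
    intro P Q hP hQ hPQ
    rw [← Finset.card_union_of_disjoint]
    · apply Finset.card_le_card
      apply Finset.union_subset
      · exact Finset.add_subset_add hP (Finset.image_subset_image hP)
      · exact Finset.add_subset_add_right hQ
    · rw [Finset.disjoint_left]
      intro z hz hz'
      obtain ⟨x, hx, _, hx2, rfl⟩ := Finset.mem_add.1 hz
      obtain ⟨x2, -, rfl⟩ := Finset.mem_image.1 hx2
      obtain ⟨y, hy, _, hy2, h⟩ := Finset.mem_add.1 hz'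
      obtain ⟨y2, -, rfl⟩ := Finset.mem_image.1 hy2
      have := congrArg Prod.fst h
      simp only [sqT_apply, Prod.fst_add] at this
      apply hPQ x hx y hy
      omega
  have hc := Finset.card_filter_add_card_filter_not (s := A) (fun x : ℤ × ℤ => x.1 % 2 = 0)
  obtain ⟨x0, hx0, hx0'⟩ := h0
  obtain ⟨x1, hx1, hx1'⟩ := h1
  by_cases hle : (A.filter (fun x => ¬ x.1 % 2 = 0)).card ≤ (A.filter (fun x => x.1 % 2 = 0)).card
  · refine ⟨A.filter (fun x => x.1 % 2 = 0), A.filter (fun x => ¬ x.1 % 2 = 0),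
      Finset.filter_subset _ _, Finset.filter_subset _ _, ⟨x1, by simp [hx1, hx1']⟩, hc, by omega,
      key _ _ (Finset.filter_subset _ _) (Finset.filter_subset _ _) ?_⟩
    intro x hx y hy
    rw [Finset.mem_filter] at hx hy
    omega
  · refine ⟨A.filter (fun x => ¬ x.1 % 2 = 0), A.filter (fun x => x.1 % 2 = 0),
      Finset.filter_subset _ _, Finset.filter_subset _ _, ⟨x0, Finset.mem_filter.2 ⟨hx0, hx0'⟩⟩, by omega,
      by omega, key _ _ (Finset.filter_subset _ _) (Finset.filter_subset _ _) ?_⟩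
    intro x hx y hy
    rw [Finset.mem_filter] at hx hy
    omega

/-- The numerical part of the induction step. -/
lemma numeric_step (C' n b s : ℝ) (hC' : 1 ≤ C') (hn : 2 ≤ n) (hb : 0 ≤ b) (hs : 0 ≤ s)
    (hbs : b + s = n) (hs2 : 2 * s ≤ n) (hbig : 2 * C' * n ^ (1 - 1 / 26 : ℝ) ≤ n) :
    (1 + Real.sqrt 2) ^ 2 * n - 20 * C' * n ^ (1 - 1 / 26 : ℝ) ≤
      ((1 + Real.sqrt 2) ^ 2 * b - 20 * C' * b ^ (1 - 1 / 26 : ℝ)) +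
        (s + n + 2 * (Real.sqrt s * Real.sqrt n) - C' * n ^ (1 - 1 / 26 : ℝ)) := by
  have hq : Real.sqrt 2 * Real.sqrt 2 = 2 := Real.mul_self_sqrt (by norm_num)
  have hq0 := Real.sqrt_nonneg 2
  have hq3 : Real.sqrt 2 ≤ 3 / 2 := by nlinarith
  have hx0 := Real.sqrt_nonneg s
  have hy0 := Real.sqrt_nonneg n
  have hx : Real.sqrt s * Real.sqrt s = s := Real.mul_self_sqrt hs
  have hy : Real.sqrt n * Real.sqrt n = n := Real.mul_self_sqrt (by linarith)
  have hexp : (1 + Real.sqrt 2) ^ 2 = 3 + 2 * Real.sqrt 2 := by nlinarith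
  have hE0 : 0 ≤ n ^ (1 - 1 / 26 : ℝ) := by positivity
  rw [hexp]
  have hb' : b = n - s := by linarith
  have hmono : b ^ (1 - 1 / 26 : ℝ) ≤ n ^ (1 - 1 / 26 : ℝ) :=
    Real.rpow_le_rpow hb (by linarith) (by norm_num)
  by_cases hcase : 10 * s ≤ n
  · have h1 : 20 * C' * b ^ (1 - 1 / 26 : ℝ) ≤ 20 * C' * n ^ (1 - 1 / 26 : ℝ) := by gcongr
    have h2 : (2 + 2 * Real.sqrt 2) * s ≤ 5 * s := by nlinarith
    have h3 : 0 ≤ Real.sqrt s * Real.sqrt n := by positivity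
    subst hb'
    nlinarith
  · have hG : 0 ≤ n + 2 * (Real.sqrt s * Real.sqrt n) - (2 + 2 * Real.sqrt 2) * s := by
      have h1 : Real.sqrt 2 * Real.sqrt s ≤ Real.sqrt n := by
        rw [← Real.sqrt_mul (by norm_num)]
        exact Real.sqrt_le_sqrt hs2
      have h2 : 0 ≤ (Real.sqrt n - Real.sqrt 2 * Real.sqrt s) *
          (Real.sqrt n + (Real.sqrt 2 + 2) * Real.sqrt s) :=
        mul_nonneg (by linarith) (by positivity)
      have h3 : (Real.sqrt n - Real.sqrt 2 * Real.sqrt s) *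
          (Real.sqrt n + (Real.sqrt 2 + 2) * Real.sqrt s) =
          n + 2 * (Real.sqrt s * Real.sqrt n) - (2 + 2 * Real.sqrt 2) * s := by
        linear_combination hy - (2 + 2 * Real.sqrt 2) * hx - Real.sqrt s * Real.sqrt s * hq
      rw [h3] at h2
      exact h2
    have hpow : b ^ (1 - 1 / 26 : ℝ) ≤ (95 / 100) * n ^ (1 - 1 / 26 : ℝ) := by
      have h1 : b ^ (1 - 1 / 26 : ℝ) ≤ ((9 / 10) * n) ^ (1 - 1 / 26 : ℝ) :=
        Real.rpow_le_rpow hb (by linarith) (by norm_num)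
      rw [Real.mul_rpow (by norm_num) (by linarith)] at h1
      have h2 : (9 / 10 : ℝ) ^ (1 - 1 / 26 : ℝ) ≤ 95 / 100 := by
        calc (9 / 10 : ℝ) ^ (1 - 1 / 26 : ℝ) ≤ (9 / 10 : ℝ) ^ (1 / 2 : ℝ) :=
              Real.rpow_le_rpow_of_exponent_ge (by norm_num) (by norm_num) (by norm_num)
          _ = Real.sqrt (9 / 10) := (Real.sqrt_eq_rpow _).symm
          _ ≤ 95 / 100 := by rw [Real.sqrt_le_left (by norm_num)]; norm_num
      refine h1.trans ?_
      gcongr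
    have h4 : 20 * C' * b ^ (1 - 1 / 26 : ℝ) ≤
        20 * C' * ((95 / 100) * n ^ (1 - 1 / 26 : ℝ)) := by gcongr
    subst hb'
    nlinarith

theorem stmt_1 :
    ∃ C ε : ℝ, 0 < C ∧ 0 < ε ∧
      ∀ A : Finset (ℤ × ℤ),
        ((Finset.image₂ (fun a b : ℤ × ℤ => a + (2 * b.2, b.1)) A A).card : ℝ) ≥
          (1 + Real.sqrt 2) ^ 2 * (A.card : ℝ) - C * (A.card : ℝ) ^ (1 - ε) := by
  obtain ⟨C', hC', hbm⟩ := bm_lemma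
  refine ⟨20 * C', 1 / 26, by linarith, by norm_num, ?_⟩
  have hc6 : (1 + Real.sqrt 2) ^ 2 ≤ 6 := by
    have hq : Real.sqrt 2 * Real.sqrt 2 = 2 := Real.mul_self_sqrt (by norm_num)
    have hq3 : Real.sqrt 2 ≤ 3 / 2 := by nlinarith [Real.sqrt_nonneg 2]
    nlinarith
  have main : ∀ n : ℕ, ∀ A : Finset (ℤ × ℤ), A.card = n →
      (1 + Real.sqrt 2) ^ 2 * (A.card : ℝ) - 20 * C' * (A.card : ℝ) ^ (1 - 1 / 26 : ℝ) ≤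
        (A + A.image sqT).card := by
    intro n
    induction n using Nat.strong_induction_on with
    | _ n ih =>
    intro A hAn
    have hE0 : 0 ≤ (A.card : ℝ) ^ (1 - 1 / 26 : ℝ) := by positivity
    have hn0 : (0 : ℝ) ≤ A.card := by positivity
    have hS0 : (0 : ℝ) ≤ (A + A.image sqT).card := by positivity
    have hc : (1 + Real.sqrt 2) ^ 2 * (A.card : ℝ) ≤ 6 * A.card := by gcongr
    by_cases hbig : 2 * C' * (A.card : ℝ) ^ (1 - 1 / 26 : ℝ) ≤ A.card
    swap
    · nlinarith
    by_cases h6 : (A + A.image sqT).card ≤ 6 * A.card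
    swap
    · have : (6 * A.card : ℝ) ≤ (A + A.image sqT).card := by exact_mod_cast (not_le.1 h6).le
      nlinarith
    by_cases hA2 : 2 ≤ A.card
    swap
    · have : A.card = 0 ∨ A.card = 1 := by omega
      rcases this with h | h
      · simp only [h, Nat.cast_zero]
        rw [Real.zero_rpow (by norm_num)]
        simp
      · simp only [h, Nat.cast_one, Real.one_rpow] at hbig
        linarith
    obtain ⟨B, hBA, hBs, he, ho⟩ := reduce_lemma A hA2
    rw [← hBs] at h6 ⊢
    rw [← hBA] at h6 hA2 hbig hAn ⊢
    obtain ⟨P, Q, hP, hQ, hQn, hPQ, hQ2, hsum⟩ := split_lemma B he ho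
    have h1 := ih P.card (by have := hQn.card_pos; omega) P rfl
    have h2 := hbm B Q hA2 h6 hQ hQn
    have h3 := numeric_step C' B.card P.card Q.card hC' (by exact_mod_cast hA2) (by positivity)
      (by positivity) (by exact_mod_cast hPQ) (by exact_mod_cast hQ2) hbig
    have h4 : ((P + P.image sqT).card : ℝ) + (Q + B.image sqT).card ≤ (B + B.image sqT).card := by
      exact_mod_cast hsum
    linarith
  intro A
  have h := main A.card A rfl
  have heq : Finset.image₂ (fun a b : ℤ × ℤ => a + (2 * b.2, b.1)) A A = A + A.image sqT := by
    ext z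
    simp [Finset.mem_image₂, Finset.mem_add, sqT_apply]
  rw [heq]
  exact h
end

section
/- Let α ∈ ℂ and let A be a finite nonempty set of complex numbers. Then there exists a finite set B contained in the ℚ-subalgebra ℚ[α] of ℂ generated by α, such that |B| = |A| and |B + α·B| ≤ |A + α·A|. -/
open scoped Classical

/-- Common denominators for finitely many elements of `ℚ(α)`. -/
lemma common_denominator (α : ℂ) (S : Finset ℂ)
    (hS : ∀ x ∈ S, x ∈ IntermediateField.adjoin ℚ {α}) :
    ∃ d : ℂ, d ≠ 0 ∧ d ∈ Algebra.adjoin ℚ {α} ∧ ∀ x ∈ S, d * x ∈ Algebra.adjoin ℚ {α} := by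
  induction S using Finset.induction_on with
  | empty => exact ⟨1, one_ne_zero, one_mem _, by simp⟩
  | insert x S hx ih =>
    obtain ⟨d, hd0, hd, h⟩ := ih fun y hy => hS y (Finset.mem_insert_of_mem hy)
    obtain ⟨r, hr, s, hs, hxrs⟩ :=
      IntermediateField.mem_adjoin_iff_div.mp (hS x (Finset.mem_insert_self _ _))
    by_cases hs0 : s = 0
    · refine ⟨d, hd0, hd, fun y hy => ?_⟩
      rcases Finset.mem_insert.mp hy with rfl | hy
      · simp [hxrs, hs0]
      · exact h y hy
    · refine ⟨s * d, mul_ne_zero hs0 hd0, mul_mem hs hd, fun y hy => ?_⟩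
      rcases Finset.mem_insert.mp hy with rfl | hy
      · have : s * d * y = d * r := by rw [hxrs]; field_simp
        rw [this]; exact mul_mem hd hr
      · rw [mul_assoc]; exact mul_mem hs (h y hy)

/-- Let `α ∈ ℂ` and let `A` be a finite nonempty set of complex numbers. Then there is a
finite set `B ⊆ ℚ[α]` with `|B| = |A|` and `|B + α·B| ≤ |A + α·A|`. -/
theorem stmt_2 (α : ℂ) (A : Finset ℂ) (hA : A.Nonempty) :
    ∃ B : Finset ℂ,
      (∀ b ∈ B, b ∈ Algebra.adjoin ℚ {α}) ∧
      B.card = A.card ∧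
      (Finset.image₂ (fun a b => a + α * b) B B).card ≤
        (Finset.image₂ (fun a b => a + α * b) A A).card := by
  let K := IntermediateField.adjoin ℚ {α}
  obtain ⟨f, hf⟩ := Module.exists_dual_forall_apply_ne_zero (K := K) (M := ℂ)
    (ι := {p : A × A // p.1 ≠ p.2}) (fun p => (p.1.1 : ℂ) - p.1.2)
    (fun p => sub_ne_zero.mpr fun h => p.2 (Subtype.ext h))
  obtain ⟨d, hd0, -, hd⟩ := common_denominator α (A.image fun a => (f a : ℂ)) (by
    intro x hx
    obtain ⟨a, -, rfl⟩ := Finset.mem_image.mp hx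
    exact (f a).2)
  let g : ℂ → ℂ := fun a => d * (f a : ℂ)
  have hg : ∀ a b, g (a + α * b) = g a + α * g b := by
    intro a b
    have h1 : α * b = (⟨α, IntermediateField.mem_adjoin_simple_self ℚ α⟩ : K) • b := rfl
    simp only [g]
    rw [h1, map_add, map_smul]
    simp
    ring
  refine ⟨A.image g, ?_, ?_, ?_⟩
  · intro b hb
    obtain ⟨a, ha, rfl⟩ := Finset.mem_image.mp hb
    exact hd _ (Finset.mem_image_of_mem _ ha)
  · apply Finset.card_image_of_injOn
    intro a ha b hb hab
    by_contra hne
    apply hf ⟨(⟨a, ha⟩, ⟨b, hb⟩), fun h => hne (congrArg Subtype.val h)⟩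
    have := mul_left_cancel₀ hd0 hab
    rw [map_sub, sub_eq_zero]
    exact Subtype.ext this
  · refine le_trans (Finset.card_le_card ?_)
      (Finset.card_image_le (f := g) (s := Finset.image₂ (fun a b => a + α * b) A A))
    intro x hx
    obtain ⟨u, hu, v, hv, rfl⟩ := Finset.mem_image₂.mp hx
    obtain ⟨a, ha, rfl⟩ := Finset.mem_image.mp hu
    obtain ⟨b, hb, rfl⟩ := Finset.mem_image.mp hv
    exact Finset.mem_image.mpr ⟨a + α * b, Finset.mem_image₂_of_mem ha hb, hg a b⟩
end

section
/- Let G be an abelian group, K ≥ 1 a real number, and let A, B ⊂ G be finite sets with |A| = |B|. Set C := A + B. If |C| ≤ K·|A|, then |C + C| ≤ K⁶·|C|. -/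
open scoped Pointwise

theorem plun3_aux {G : Type*} [AddCommGroup G] [DecidableEq G] (K : ℝ)
    (A B : Finset G) (hA : A.Nonempty)
    (h : ((A + B).card : ℝ) ≤ K * (A.card : ℝ)) :
    ((B + (B + B)).card : ℝ) ≤ K ^ 3 * A.card := by
  have h1 := Finset.pluennecke_ruzsa_inequality_nsmul_add hA B 3
  have h2 : 3 • B = B + (B + B) := by
    rw [succ_nsmul, two_nsmul, add_assoc]
  rw [h2] at h1
  have h3 : ((B + (B + B)).card : ℝ) ≤ ((A + B).card / A.card : ℝ) ^ 3 * A.card := by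
    have h4 := (NNRat.cast_le (K := ℝ)).2 h1
    push_cast at h4
    exact h4
  have hpos : (0 : ℝ) < A.card := by exact_mod_cast hA.card_pos
  refine h3.trans ?_
  have : ((A + B).card / A.card : ℝ) ≤ K := by rwa [div_le_iff₀ hpos]
  gcongr

/-- Let `G` be an abelian group, `K ≥ 1`, and `A, B ⊆ G` finite sets with `|A| = |B|`.
Set `C := A + B`. If `|C| ≤ K·|A|` then `|C + C| ≤ K⁶·|C|`. -/
theorem stmt_3 {G : Type*} [AddCommGroup G] [DecidableEq G] (K : ℝ) (hK : 1 ≤ K)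
    (A B : Finset G) (hcard : A.card = B.card)
    (h : ((A + B).card : ℝ) ≤ K * (A.card : ℝ)) :
    (((A + B) + (A + B)).card : ℝ) ≤ K ^ 6 * ((A + B).card : ℝ) := by
  rcases A.eq_empty_or_nonempty with rfl | hA
  · simp
  have hB : B.Nonempty := by
    rw [← Finset.card_pos, ← hcard]; exact hA.card_pos
  have hpos : (0 : ℝ) < A.card := by exact_mod_cast hA.card_pos
  have hb : ((B + (B + B)).card : ℝ) ≤ K ^ 3 * A.card := plun3_aux K A B hA h
  have ha : ((A + (A + A)).card : ℝ) ≤ K ^ 3 * A.card := by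
    have := plun3_aux K B A hB (by rw [add_comm, ← hcard]; exact h)
    rwa [← hcard] at this
  have t1 : (((A + A) + (B + B)).card : ℝ) * A.card ≤
      ((A + A) + A).card * (A + (B + B)).card := by
    exact_mod_cast Finset.ruzsa_triangle_inequality_add_add_add (A + A) A (B + B)
  have t2 : ((A + (B + B)).card : ℝ) * A.card ≤ (A + B).card * (B + (B + B)).card := by
    rw [hcard]
    exact_mod_cast Finset.ruzsa_triangle_inequality_add_add_add A B (B + B)
  rw [add_add_add_comm]
  rw [add_comm (A + A) A] at t1
  have hK0 : 0 ≤ K := by linarith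
  have u2 : ((A + (B + B)).card : ℝ) ≤ K ^ 3 * (A + B).card := by
    refine le_of_mul_le_mul_right (t2.trans ?_) hpos
    calc _ ≤ ((A + B).card : ℝ) * (K ^ 3 * A.card) := by gcongr
      _ = _ := by ring
  refine le_of_mul_le_mul_right (t1.trans ?_) hpos
  calc _ ≤ (K ^ 3 * A.card) * (K ^ 3 * (A + B).card) := by gcongr
    _ = _ := by ring
end

section
/- Let T : ℤ² → ℤ² be the map T(a,b) = (2b, a). For every finite nonempty set A ⊂ ℤ², |A + T(A)| ≥ (1+√2)²·|A| − 60·|A|^(1/2) − 6·(log |A|)·(φ_x(A) + φ_y(A)), where log is the natural logarithm. -/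
lemma swap_aux (U : Finset ℕ) (S : Finset ℤ) (p : ℕ → ℤ → Prop) [∀ u y, Decidable (p u y)] :
    ∑ u ∈ U, (S.filter (fun y => p u y)).card = ∑ y ∈ S, (U.filter (fun u => p u y)).card := by
  simp only [Finset.card_filter]
  rw [Finset.sum_comm]

open scoped Pointwise in
/-- Discrete two-dimensional Brunn-Minkowski inequality on row-level sets. -/
lemma bm_aux (X Y : Finset (ℤ × ℤ)) (hX : X.Nonempty) (hY : Y.Nonempty) :
    ((X + Y).card : ℝ) ≥ (Real.sqrt X.card + Real.sqrt Y.card) ^ 2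
      - (X.image Prod.fst).card - (X.image Prod.snd).card
      - (Y.image Prod.fst).card - (Y.image Prod.snd).card := by
  classical
  let row : Finset (ℤ × ℤ) → ℤ → Finset ℤ := fun Z y => (Z.filter (fun p => p.2 = y)).image Prod.fst
  have mem_row : ∀ Z y x, x ∈ row Z y ↔ (x, y) ∈ Z := by
    intro Z y x
    simp only [row, Finset.mem_image, Finset.mem_filter]
    constructor
    · rintro ⟨⟨a, b⟩, ⟨h1, h2⟩, h3⟩
      simp only at h2 h3
      subst h2 h3
      exact h1
    · intro h
      exact ⟨(x, y), ⟨h, rfl⟩, rfl⟩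
  have card_row : ∀ Z : Finset (ℤ × ℤ), Z.card = ∑ y ∈ Z.image Prod.snd, (row Z y).card := by
    intro Z
    rw [Finset.card_eq_sum_card_image Prod.snd Z]
    apply Finset.sum_congr rfl
    intro y _
    simp only [row]
    rw [Finset.card_image_of_injOn]
    rintro ⟨a, b⟩ h1 ⟨c, d⟩ h2 h3
    simp only [Finset.coe_filter, Set.mem_ofPred_eq] at h1 h2 h3
    ext
    · exact h3
    · rw [h1.2, h2.2]
  have row_sub : ∀ Z y, (row Z y).card ≤ (Z.image Prod.fst).card := by
    intro Z y
    exact Finset.card_le_card (Finset.image_subset_image (Finset.filter_subset _ _))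
  have row_pos : ∀ Z, ∀ y ∈ Z.image Prod.snd, 1 ≤ (row Z y).card := by
    intro Z y hy
    obtain ⟨⟨a, b⟩, h1, h2⟩ := Finset.mem_image.1 hy
    simp only at h2
    subst h2
    exact Finset.card_pos.2 ⟨a, (mem_row _ _ _).2 h1⟩
  obtain ⟨y0, hy0, hM⟩ := Finset.exists_max_image (X.image Prod.snd) (fun y => (row X y).card)
    (hX.image _)
  obtain ⟨y1, hy1, hP⟩ := Finset.exists_max_image (Y.image Prod.snd) (fun y => (row Y y).card)
    (hY.image _)
  have hM1 := row_pos X y0 hy0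
  have hP1 := row_pos Y y1 hy1
  have hMx := row_sub X y0
  have hPx := row_sub Y y1
  obtain ⟨M, hMe⟩ : ∃ M, M = (row X y0).card := ⟨_, rfl⟩
  obtain ⟨P, hPe⟩ : ∃ P, P = (row Y y1).card := ⟨_, rfl⟩
  simp only [← hMe] at hM hM1 hMx
  simp only [← hPe] at hP hP1 hPx
  let U := Finset.Icc 1 (M + P - 1)
  -- level sets
  have key : ∀ u ∈ U, ((X.image Prod.snd).filter (fun y => u * M < (row X y).card * (M + P))).card
      + ((Y.image Prod.snd).filter (fun y => u * P ≤ (row Y y).card * (M + P))).card ≤ (((X + Y).image Prod.snd).filter (fun y => u ≤ (row (X + Y) y).card)).card + 1 := by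
    intro u hu
    have hu1 := (Finset.mem_Icc.1 hu).1
    have hu2 : u + 1 ≤ M + P := by have := (Finset.mem_Icc.1 hu).2; omega
    have n1 : ((X.image Prod.snd).filter (fun y => u * M < (row X y).card * (M + P))).Nonempty := by
      refine ⟨y0, Finset.mem_filter.2 ⟨hy0, ?_⟩⟩
      rw [← hMe]
      nlinarith
    have n2 : ((Y.image Prod.snd).filter (fun y => u * P ≤ (row Y y).card * (M + P))).Nonempty := by
      refine ⟨y1, Finset.mem_filter.2 ⟨hy1, ?_⟩⟩
      rw [← hPe]
      nlinarith
    have cd := cauchy_davenport_add_of_linearOrder_isCancelAdd n1 n2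
    have sub : (X.image Prod.snd).filter (fun y => u * M < (row X y).card * (M + P)) + (Y.image Prod.snd).filter (fun y => u * P ≤ (row Y y).card * (M + P))
        ⊆ ((X + Y).image Prod.snd).filter (fun y => u ≤ (row (X + Y) y).card) := by
      intro z hz
      obtain ⟨a, ha, b, hb, rfl⟩ := Finset.mem_add.1 hz
      obtain ⟨ha1, ha2⟩ := Finset.mem_filter.1 ha
      obtain ⟨hb1, hb2⟩ := Finset.mem_filter.1 hb
      have hra := row_pos X a ha1
      have hrb := row_pos Y b hb1
      have c1 := cauchy_davenport_add_of_linearOrder_isCancelAdd (Finset.card_pos.1 hra)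
        (Finset.card_pos.1 hrb)
      have c2 : row X a + row Y b ⊆ row (X + Y) (a + b) := by
        intro w hw
        obtain ⟨x, hx, y, hy, rfl⟩ := Finset.mem_add.1 hw
        rw [mem_row] at *
        exact Finset.mem_add.2 ⟨_, hx, _, hy, rfl⟩
      have c3 := Finset.card_le_card c2
      have c4 : u ≤ (row X a).card + (row Y b).card - 1 := by
        generalize (row X a).card = f at *
        generalize (row Y b).card = g at *
        have : u * (M + P) < (f + g) * (M + P) := by nlinarith
        have h5 : u < f + g := Nat.lt_of_mul_lt_mul_right this
        omega
      have c5 := c4.trans (c1.trans c3)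
      refine Finset.mem_filter.2 ⟨?_, c5⟩
      obtain ⟨x, hx⟩ := Finset.card_pos.1 (lt_of_lt_of_le hu1 c5)
      rw [mem_row] at hx
      exact Finset.mem_image.2 ⟨_, hx, rfl⟩
    have := Finset.card_le_card sub
    omega
  have tot := Finset.sum_le_sum key
  rw [Finset.sum_add_distrib, Finset.sum_add_distrib, swap_aux U _ (fun u y => u * M < (row X y).card * (M + P)),
    swap_aux U _ (fun u y => u * P ≤ (row Y y).card * (M + P)), swap_aux U _ (fun u y => u ≤ (row (X + Y) y).card)] at tot
  have e1 : ∑ _u ∈ U, 1 = M + P - 1 := by simp [U]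
  have e2 : ∑ y ∈ (X + Y).image Prod.snd, (U.filter (fun u => u ≤ (row (X + Y) y).card)).card
      ≤ (X + Y).card := by
    rw [card_row (X + Y)]
    apply Finset.sum_le_sum
    intro y _
    have : U.filter (fun u => u ≤ (row (X + Y) y).card) ⊆ Finset.Icc 1 (row (X + Y) y).card := by
      intro u hu
      simp only [U, Finset.mem_filter, Finset.mem_Icc] at hu ⊢
      omega
    simpa using Finset.card_le_card this
  have cnt : ∀ m f : ℕ, 1 ≤ m → 1 ≤ f → f ≤ m → m ≤ M + P →
      f * (M + P) ≤ ((U.filter (fun u => u * m < f * (M + P))).card + 1) * m := by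
    intro m f hm hf hfm hmL
    obtain ⟨k, hk⟩ : ∃ k, k = (f * (M + P) - 1) / m := ⟨_, rfl⟩
    have hpos : 1 ≤ f * (M + P) := Nat.mul_pos hf (by omega)
    have k1 : k * m < f * (M + P) := by
      have := Nat.div_mul_le_self (f * (M + P) - 1) m
      rw [← hk] at this
      omega
    have k2 : f * (M + P) ≤ (k + 1) * m := by
      have := Nat.lt_div_mul_add (a := f * (M + P) - 1) (b := m) hm
      rw [← hk] at this
      rw [add_mul, one_mul]
      omega
    have k3 : k < M + P := by
      have : k * m < (M + P) * m := by nlinarith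
      exact Nat.lt_of_mul_lt_mul_right this
    have sub : Finset.Icc 1 k ⊆ U.filter (fun u => u * m < f * (M + P)) := by
      intro u hu
      simp only [U, Finset.mem_filter, Finset.mem_Icc] at hu ⊢
      refine ⟨by omega, ?_⟩
      exact lt_of_le_of_lt (Nat.mul_le_mul_right m hu.2) k1
    have := Finset.card_le_card sub
    rw [Nat.card_Icc] at this
    exact k2.trans (Nat.mul_le_mul_right m (by omega))
  have sX : X.card * (M + P) ≤ (∑ y ∈ X.image Prod.snd,
      (U.filter (fun u => u * M < (row X y).card * (M + P))).card
        + (X.image Prod.snd).card) * M := by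
    rw [card_row X, Finset.card_eq_sum_ones (X.image Prod.snd), ← Finset.sum_add_distrib,
      Finset.sum_mul, Finset.sum_mul]
    apply Finset.sum_le_sum
    intro y hy
    exact cnt M _ hM1 (row_pos X y hy) (hM y hy) (by omega)
  have sY : Y.card * (M + P) ≤ (∑ y ∈ Y.image Prod.snd,
      (U.filter (fun u => u * P ≤ (row Y y).card * (M + P))).card
        + (Y.image Prod.snd).card) * P := by
    rw [card_row Y, Finset.card_eq_sum_ones (Y.image Prod.snd), ← Finset.sum_add_distrib,
      Finset.sum_mul, Finset.sum_mul]
    apply Finset.sum_le_sum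
    intro y hy
    refine (cnt P _ hP1 (row_pos Y y hy) (hP y hy) (by omega)).trans ?_
    refine Nat.mul_le_mul_right _ (Nat.add_le_add_right (Finset.card_le_card ?_) 1)
    intro u hu
    rw [Finset.mem_filter] at hu ⊢
    exact ⟨hu.1, hu.2.le⟩
  clear key cnt
  generalize (∑ y ∈ X.image Prod.snd,
      (U.filter (fun u => u * M < (row X y).card * (M + P))).card) = a at *
  generalize (∑ y ∈ Y.image Prod.snd,
      (U.filter (fun u => u * P ≤ (row Y y).card * (M + P))).card) = b at *
  have tot2 : a + b + 1 ≤ (X + Y).card + M + P := by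
    rw [e1] at tot
    omega
  have tot3 : (a : ℝ) + b + 1 ≤ (X + Y).card + M + P := by exact_mod_cast tot2
  have sX3 : (X.card : ℝ) * (M + P) ≤ (a + (X.image Prod.snd).card) * M := by exact_mod_cast sX
  have sY3 : (Y.card : ℝ) * (M + P) ≤ (b + (Y.image Prod.snd).card) * P := by exact_mod_cast sY
  have hMx3 : (M : ℝ) ≤ (X.image Prod.fst).card := by exact_mod_cast hMx
  have hPx3 : (P : ℝ) ≤ (Y.image Prod.fst).card := by exact_mod_cast hPx
  have hM3 : (0 : ℝ) < M := by exact_mod_cast hM1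
  have hP3 : (0 : ℝ) < P := by exact_mod_cast hP1
  have q1 := Real.sq_sqrt (Nat.cast_nonneg (α := ℝ) X.card)
  have q2 := Real.sq_sqrt (Nat.cast_nonneg (α := ℝ) Y.card)
  generalize Real.sqrt X.card = x at *
  generalize Real.sqrt Y.card = y at *
  rw [← q1] at sX3
  rw [← q2] at sY3
  have r1 : x ^ 2 * (M + P) / M ≤ a + (X.image Prod.snd).card := (div_le_iff₀ hM3).2 sX3
  have r2 : y ^ 2 * (M + P) / P ≤ b + (Y.image Prod.snd).card := (div_le_iff₀ hP3).2 sY3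
  have r3 : (x + y) ^ 2 ≤ x ^ 2 * (M + P) / M + y ^ 2 * (M + P) / P := by
    have : x ^ 2 * (M + P) / M + y ^ 2 * (M + P) / P - (x + y) ^ 2
        = (x * P - y * M) ^ 2 / (M * P) := by
      field_simp
      ring
    have h0 : 0 ≤ (x * P - y * M) ^ 2 / (M * P) := by positivity
    linarith
  linarith

lemma real_aux (n m p F F' f g : ℝ) (hm : 1 ≤ m) (hp : 1 ≤ p) (hn : n = m + p) (hmp : m ≤ p)
    (hF : F' ≤ F) (hF0 : 0 ≤ F')
    (hf : f ≥ (1 + Real.sqrt 2) ^ 2 * p - 60 * Real.sqrt p - 6 * Real.log p * F')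
    (hf0 : 0 ≤ f)
    (hg : g ≥ (Real.sqrt m + Real.sqrt n) ^ 2 - 2 * F) (hg0 : 0 ≤ g) :
    f + g ≥ (1 + Real.sqrt 2) ^ 2 * n - 60 * Real.sqrt n - 6 * Real.log n * F := by
  have s2 := Real.sq_sqrt (show (0 : ℝ) ≤ 2 by norm_num)
  have s2p := Real.sqrt_nonneg 2
  have s2u : Real.sqrt 2 ≤ 1.41422 := Real.sqrt_le_iff.2 ⟨by norm_num, by norm_num⟩
  have K : (1 + Real.sqrt 2) ^ 2 ≤ 5.82844 := by nlinarith
  have xm := Real.sq_sqrt (show 0 ≤ m by linarith)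
  have yn := Real.sq_sqrt (show 0 ≤ n by linarith)
  have xp := Real.sqrt_nonneg m
  have yp := Real.sqrt_nonneg n
  have spn : Real.sqrt p ≤ Real.sqrt n := Real.sqrt_le_sqrt (by linarith)
  have lp : 0 ≤ Real.log p := Real.log_nonneg hp
  have lpn : Real.log p ≤ Real.log n := Real.log_le_log (by linarith) (by linarith)
  have hFF : Real.log p * F' ≤ Real.log p * F := mul_le_mul_of_nonneg_left hF lp
  have e1 : (2.7182818283 : ℝ) < Real.exp 1 := Real.exp_one_gt_d9
  have e2 : Real.exp 1 < 2.7182818286 := Real.exp_one_lt_d9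
  rcases le_or_gt (3 * n) (10 * m) with h | h
  · have l1 : Real.log p ≤ Real.log n - 1 / 3 := by
      have a1 : Real.log p ≤ Real.log (n * (7 / 10)) := Real.log_le_log (by linarith) (by linarith)
      rw [Real.log_mul (by linarith) (by norm_num)] at a1
      have a2 : Real.log ((7 / 10 : ℝ) ^ 3) ≤ -1 := by
        rw [Real.log_le_iff_le_exp (by norm_num), Real.exp_neg]
        rw [le_inv_comm₀ (by norm_num) (by positivity)]
        norm_num at e2 ⊢
        linarith
      rw [Real.log_pow] at a2
      norm_num at a1 a2
      linarith
    have k1 : (1 + Real.sqrt 2) ^ 2 * m ≤ (Real.sqrt m + Real.sqrt n) ^ 2 := by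
      have : Real.sqrt 2 * Real.sqrt m ≤ Real.sqrt n := by
        rw [← Real.sqrt_mul (by norm_num)]
        exact Real.sqrt_le_sqrt (by linarith)
      rw [← xm, ← mul_pow]
      rw [xm]
      apply pow_le_pow_left₀ (by positivity)
      linarith
    have : Real.log p * F ≤ (Real.log n - 1 / 3) * F :=
      mul_le_mul_of_nonneg_right l1 (by linarith)
    have hK : (1 + Real.sqrt 2) ^ 2 * n = (1 + Real.sqrt 2) ^ 2 * m + (1 + Real.sqrt 2) ^ 2 * p := by
      rw [hn]; ring
    linarith
  · rcases le_or_gt F (0.32 * n) with h' | h'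
    · have hK : (1 + Real.sqrt 2) ^ 2 * n
          = (1 + Real.sqrt 2) ^ 2 * m + (1 + Real.sqrt 2) ^ 2 * p := by
        rw [hn]; ring
      have k1 : (1 + Real.sqrt 2) ^ 2 * m + 0.64 * n ≤ (Real.sqrt m + Real.sqrt n) ^ 2 := by
        have hKm : (1 + Real.sqrt 2) ^ 2 * m ≤ 5.82844 * m :=
          mul_le_mul_of_nonneg_right K (by linarith)
        have hxy : Real.sqrt m ≤ 0.5478 * Real.sqrt n := by
          apply abs_le_of_sq_le_sq' _ (by positivity) |>.2
          rw [mul_pow, xm, yn]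
          linarith
        have hxx : Real.sqrt m * Real.sqrt m ≤ Real.sqrt m * (0.5478 * Real.sqrt n) :=
          mul_le_mul_of_nonneg_left hxy xp
        have hn0 : 0 ≤ n := by linarith
        clear * - xm yn hKm hxx h hn0
        have hsq : (Real.sqrt m + Real.sqrt n) ^ 2 = m + n + 2 * (Real.sqrt m * Real.sqrt n) := by
          rw [add_sq, xm, yn]; ring
        have hmm : Real.sqrt m * Real.sqrt m = m := by rw [← sq, xm]
        rw [hsq]
        linarith
      have : Real.log p * F ≤ Real.log n * F :=
        mul_le_mul_of_nonneg_right lpn (by linarith)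
      linarith
    · have hKn : (1 + Real.sqrt 2) ^ 2 * n ≤ 5.82844 * n :=
          mul_le_mul_of_nonneg_right K (by linarith)
      have ln0 : 0 ≤ Real.log n := lp.trans lpn
      rcases le_or_gt n 100 with h1 | h1
      · have : Real.sqrt n ≤ 10 := Real.sqrt_le_iff.2 ⟨by norm_num, by linarith⟩
        have : 0 ≤ Real.log n * F := mul_nonneg ln0 (by linarith)
        have : Real.sqrt n * Real.sqrt n ≤ 10 * Real.sqrt n := by
          apply mul_le_mul_of_nonneg_right _ yp
          assumption
        rw [← sq, yn] at this
        linarith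
      · have l4 : 4 ≤ Real.log n := by
          rw [Real.le_log_iff_exp_le (by linarith)]
          have : Real.exp 4 = Real.exp 1 ^ 4 := by
            rw [← Real.exp_nat_mul]; norm_num
          rw [this]
          have : Real.exp 1 ^ 4 ≤ 3 ^ 4 := pow_le_pow_left₀ (by positivity) (by linarith) 4
          linarith
        have : 4 * (0.32 * n) ≤ Real.log n * F := by
          apply mul_le_mul l4 h'.le (by linarith) ln0
        linarith

open scoped Pointwise in
lemma step_aux (A : Finset (ℤ × ℤ)) (r s : ℤ) (hrs : (r = 0 ∧ s = 1) ∨ (r = 1 ∧ s = 0)) :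
    (Finset.image₂ (fun a b : ℤ × ℤ => a + (2 * b.2, b.1))
        ((A.filter (fun a => a.1 % 2 = s)).image (fun a => (a.2, (a.1 - s) / 2)))
        ((A.filter (fun a => a.1 % 2 = s)).image (fun a => (a.2, (a.1 - s) / 2)))).card
      + ((A.filter (fun a => a.1 % 2 = r)).image (fun a => ((a.1 - r) / 2, a.2))
          + A.image Prod.swap).card
      ≤ (Finset.image₂ (fun a b : ℤ × ℤ => a + (2 * b.2, b.1)) A A).card := by
  classical
  have i1 : Function.Injective (fun z : ℤ × ℤ => (2 * z.2 + s, z.1 + s)) := by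
    rintro ⟨a, b⟩ ⟨c, d⟩ h
    simp only [Prod.mk.injEq] at h ⊢
    omega
  have i2 : Function.Injective (fun z : ℤ × ℤ => (2 * z.1 + r, z.2)) := by
    rintro ⟨a, b⟩ ⟨c, d⟩ h
    simp only [Prod.mk.injEq] at h ⊢
    omega
  refine le_trans (Nat.add_le_add (Finset.card_image_of_injective _ i1).ge
    (Finset.card_image_of_injective _ i2).ge) ?_
  rw [← Finset.card_union_of_disjoint]
  · apply Finset.card_le_card
    apply Finset.union_subset
    · intro z hz
      simp only [Finset.mem_image, Finset.mem_image₂, Finset.mem_filter] at hz ⊢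
      obtain ⟨_, ⟨_, ⟨a, ⟨ha, ha2⟩, rfl⟩, _, ⟨b, ⟨hb, hb2⟩, rfl⟩, rfl⟩, rfl⟩ := hz
      refine ⟨a, ha, b, hb, ?_⟩
      ext
      · simp only [Prod.fst_add, Prod.snd_add]
        omega
      · simp only [Prod.fst_add, Prod.snd_add]
        omega
    · intro z hz
      simp only [Finset.mem_image, Finset.mem_add, Finset.mem_image₂, Finset.mem_filter] at hz ⊢
      obtain ⟨_, ⟨_, ⟨a, ⟨ha, ha2⟩, rfl⟩, _, ⟨b, hb, rfl⟩, rfl⟩, rfl⟩ := hz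
      refine ⟨a, ha, b, hb, ?_⟩
      ext
      · simp only [Prod.fst_add, Prod.fst_swap]
        omega
      · simp only [Prod.snd_add, Prod.snd_swap]
  · rw [Finset.disjoint_left]
    intro z h1 h2
    obtain ⟨a, _, rfl⟩ := Finset.mem_image.1 h1
    obtain ⟨b, _, h⟩ := Finset.mem_image.1 h2
    simp only [Prod.mk.injEq] at h
    omega

lemma main_aux (N : ℕ) : ∀ A : Finset (ℤ × ℤ), A.Nonempty →
    (∀ a ∈ A, ∀ b ∈ A, 2 * |a.1 - b.1| + 3 * |a.2 - b.2| ≤ (N : ℤ)) →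
    ((Finset.image₂ (fun a b : ℤ × ℤ => a + (2 * b.2, b.1)) A A).card : ℝ) ≥
      (1 + Real.sqrt 2) ^ 2 * (A.card : ℝ) - 60 * Real.sqrt (A.card : ℝ) -
        6 * Real.log (A.card : ℝ) *
          (((A.image Prod.fst).card : ℝ) + ((A.image Prod.snd).card : ℝ)) := by
  classical
  induction N with
  | zero =>
    intro A hA h
    have h1 : A.card = 1 := by
      apply le_antisymm _ (Finset.card_pos.2 hA)
      rw [Finset.card_le_one]
      intro a ha b hb
      have := h a ha b hb
      have p1 := abs_nonneg (a.1 - b.1)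
      have p2 := abs_nonneg (a.2 - b.2)
      push_cast at this
      have q1 : |a.1 - b.1| = 0 := by omega
      have q2 : |a.2 - b.2| = 0 := by omega
      rw [abs_eq_zero] at q1 q2
      ext <;> omega
    rw [h1]
    have s2u : Real.sqrt 2 ≤ 1.41422 := Real.sqrt_le_iff.2 ⟨by norm_num, by norm_num⟩
    have s2p := Real.sqrt_nonneg 2
    have K : (1 + Real.sqrt 2) ^ 2 ≤ 60 := by nlinarith
    have : (0 : ℝ) ≤ ((Finset.image₂ (fun a b : ℤ × ℤ => a + (2 * b.2, b.1)) A A).card : ℝ) :=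
      Nat.cast_nonneg _
    simp only [Nat.cast_one, Real.sqrt_one, Real.log_one]
    linarith
  | succ N ih =>
    intro A hA hN
    obtain ⟨r, s, hrs, hle⟩ : ∃ r s : ℤ, ((r = 0 ∧ s = 1) ∨ (r = 1 ∧ s = 0)) ∧
        (A.filter (fun a => a.1 % 2 = r)).card ≤ (A.filter (fun a => a.1 % 2 = s)).card := by
      rcases le_total (A.filter (fun a => a.1 % 2 = 0)).card
        (A.filter (fun a => a.1 % 2 = 1)).card with h | h
      · exact ⟨0, 1, Or.inl ⟨rfl, rfl⟩, h⟩
      · exact ⟨1, 0, Or.inr ⟨rfl, rfl⟩, h⟩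
    have step := step_aux A r s hrs
    have hcard : A.card = (A.filter (fun a => a.1 % 2 = r)).card
        + (A.filter (fun a => a.1 % 2 = s)).card := by
      rw [← Finset.card_filter_add_card_filter_not (s := A) (fun a => a.1 % 2 = r)]
      congr 2
      apply Finset.filter_congr
      intro a _
      omega
    obtain ⟨R, hR⟩ : ∃ R, R = A.filter (fun a => a.1 % 2 = r) := ⟨_, rfl⟩
    obtain ⟨S, hS⟩ : ∃ S, S = A.filter (fun a => a.1 % 2 = s) := ⟨_, rfl⟩
    rw [← hR, ← hS] at step hcard hle
    have hRA : R ⊆ A := hR ▸ Finset.filter_subset _ _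
    have hSA : S ⊆ A := hS ▸ Finset.filter_subset _ _
    have hRm : ∀ a ∈ R, a.1 % 2 = r := fun a ha => by
      rw [hR] at ha
      exact (Finset.mem_filter.1 ha).2
    have hSm : ∀ a ∈ S, a.1 % 2 = s := fun a ha => by
      rw [hS] at ha
      exact (Finset.mem_filter.1 ha).2
    clear hR hS
    have hApos := Finset.card_pos.2 hA
    have hSpos : 0 < S.card := by omega
    have hSne := Finset.card_pos.1 hSpos
    obtain ⟨B, hB⟩ : ∃ B, B = S.image (fun a => (a.2, (a.1 - s) / 2)) := ⟨_, rfl⟩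
    obtain ⟨X, hX⟩ : ∃ X, X = R.image (fun a => ((a.1 - r) / 2, a.2)) := ⟨_, rfl⟩
    rw [← hB, ← hX] at step
    have cB : B.card = S.card := by
      rw [hB]
      apply Finset.card_image_of_injOn
      rintro ⟨a, b⟩ h1 ⟨c, d⟩ h2 h
      have h1 := hSm _ h1
      have h2 := hSm _ h2
      simp only [Prod.mk.injEq] at h h1 h2 ⊢
      omega
    have cX : X.card = R.card := by
      rw [hX]
      apply Finset.card_image_of_injOn
      rintro ⟨a, b⟩ h1 ⟨c, d⟩ h2 h
      have h1 := hRm _ h1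
      have h2 := hRm _ h2
      simp only [Prod.mk.injEq] at h h1 h2 ⊢
      omega
    have B1 : (B.image Prod.fst).card ≤ (A.image Prod.snd).card := by
      rw [hB, Finset.image_image]
      exact Finset.card_le_card (Finset.image_subset_image hSA)
    have B2 : (B.image Prod.snd).card ≤ (A.image Prod.fst).card := by
      have : B.image Prod.snd = (S.image Prod.fst).image (fun x => (x - s) / 2) := by
        rw [hB, Finset.image_image, Finset.image_image]
        rfl
      rw [this]
      exact Finset.card_image_le.trans (Finset.card_le_card (Finset.image_subset_image hSA))
    have X1 : (X.image Prod.snd).card ≤ (A.image Prod.snd).card := by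
      rw [hX, Finset.image_image]
      exact Finset.card_le_card (Finset.image_subset_image hRA)
    have X2 : (X.image Prod.fst).card ≤ (A.image Prod.fst).card := by
      have : X.image Prod.fst = (R.image Prod.fst).image (fun x => (x - r) / 2) := by
        rw [hX, Finset.image_image, Finset.image_image]
        rfl
      rw [this]
      exact Finset.card_image_le.trans (Finset.card_le_card (Finset.image_subset_image hRA))
    have hBN : ∀ a ∈ B, ∀ b ∈ B, 2 * |a.1 - b.1| + 3 * |a.2 - b.2| ≤ (N : ℤ) := by
      intro a ha b hb
      rw [hB] at ha hb
      obtain ⟨c, hc, rfl⟩ := Finset.mem_image.1 ha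
      obtain ⟨d, hd, rfl⟩ := Finset.mem_image.1 hb
      have h1 := hSm c hc
      have h2 := hSm d hd
      have h3 := hN c (hSA hc) d (hSA hd)
      push_cast at h3
      simp only
      have h4 : |c.1 - d.1| = 2 * |(c.1 - s) / 2 - (d.1 - s) / 2| := by
        rw [← abs_two (α := ℤ), ← abs_mul, abs_two]
        congr 1
        omega
      have p1 := abs_nonneg (c.2 - d.2)
      have p2 := abs_nonneg ((c.1 - s) / 2 - (d.1 - s) / 2)
      omega
    have IH := ih B (hB ▸ hSne.image _) hBN
    rw [cB] at IH
    have hBr1 : ((B.image Prod.fst).card : ℝ) ≤ (A.image Prod.snd).card := by exact_mod_cast B1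
    have hBr2 : ((B.image Prod.snd).card : ℝ) ≤ (A.image Prod.fst).card := by exact_mod_cast B2
    have hXr1 : ((X.image Prod.snd).card : ℝ) ≤ (A.image Prod.snd).card := by exact_mod_cast X1
    have hXr2 : ((X.image Prod.fst).card : ℝ) ≤ (A.image Prod.fst).card := by exact_mod_cast X2
    rcases Nat.eq_zero_or_pos R.card with h0 | h0
    · have hAS : A.card = S.card := by omega
      have hst : (((Finset.image₂ (fun a b : ℤ × ℤ => a + (2 * b.2, b.1)) B B).card : ℕ) : ℝ) ≤
          (Finset.image₂ (fun a b : ℤ × ℤ => a + (2 * b.2, b.1)) A A).card := by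
        exact_mod_cast (le_trans (Nat.le_add_right _ _) step)
      rw [hAS]
      have lp : 0 ≤ Real.log (S.card : ℝ) := Real.log_natCast_nonneg _
      have : Real.log (S.card : ℝ) * (((B.image Prod.fst).card : ℝ) + (B.image Prod.snd).card)
          ≤ Real.log (S.card : ℝ) * (((A.image Prod.fst).card : ℝ) + (A.image Prod.snd).card) :=
        mul_le_mul_of_nonneg_left (by linarith) lp
      linarith
    · have hXne : X.Nonempty := Finset.card_pos.1 (by omega)
      have BM := bm_aux X (A.image Prod.swap) hXne (hA.image _)
      have Y1 : (A.image Prod.swap).image Prod.fst = A.image Prod.snd := by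
        rw [Finset.image_image]
        rfl
      have Y2 : (A.image Prod.swap).image Prod.snd = A.image Prod.fst := by
        rw [Finset.image_image]
        rfl
      rw [Y1, Y2, cX, Finset.card_image_of_injective _ Prod.swap_injective] at BM
      refine ge_trans (b := (_ : ℝ) + _) ?_ (real_aux (A.card : ℝ) R.card S.card
        (((A.image Prod.fst).card : ℝ) + ((A.image Prod.snd).card : ℝ)) _ _ _
        (by exact_mod_cast h0) (by exact_mod_cast hSpos) (by exact_mod_cast hcard)
        (by exact_mod_cast hle) ?_ ?_ IH (Nat.cast_nonneg _)
        (le_trans ?_ BM) (Nat.cast_nonneg _))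
      · exact_mod_cast step
      · linarith
      · positivity
      · linarith

/-- Let `T : ℤ² → ℤ²` be `T (a, b) = (2b, a)`. For every finite nonempty `A ⊆ ℤ²`,
`|A + T(A)| ≥ (1+√2)² |A| - 60 |A|^(1/2) - 6 (log |A|) (φ_x(A) + φ_y(A))`. -/
theorem stmt_4 (A : Finset (ℤ × ℤ)) (hA : A.Nonempty) :
    ((Finset.image₂ (fun a b : ℤ × ℤ => a + (2 * b.2, b.1)) A A).card : ℝ) ≥
      (1 + Real.sqrt 2) ^ 2 * (A.card : ℝ) - 60 * (A.card : ℝ) ^ ((1 : ℝ) / 2) -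
        6 * Real.log (A.card : ℝ) *
          (((A.image Prod.fst).card : ℝ) + ((A.image Prod.snd).card : ℝ)) := by
  rw [← Real.sqrt_eq_rpow]
  refine main_aux ((A ×ˢ A).sup
    (fun p => (2 * |p.1.1 - p.2.1| + 3 * |p.1.2 - p.2.2|).toNat)) A hA ?_
  intro a ha b hb
  have h := Finset.le_sup (f := fun p : (ℤ × ℤ) × (ℤ × ℤ) =>
    (2 * |p.1.1 - p.2.1| + 3 * |p.1.2 - p.2.2|).toNat) (Finset.mk_mem_product ha hb)
  simp only at h
  exact Int.toNat_le.1 h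
end

section
/- Let N, M be positive integers and let A := {x + y√2 : x, y ∈ ℤ, 0 ≤ x < N, 0 ≤ y < M} ⊂ ℝ. Then |A| = N·M and |A + √2·A| ≤ (N + 2M)·(M + N). -/
/-- Let `N, M` be positive integers and
`A = {x + y√2 : x, y ∈ ℤ, 0 ≤ x < N, 0 ≤ y < M}`. Then `|A| = N·M` and
`|A + √2·A| ≤ (N + 2M)(M + N)`. -/
theorem stmt_8 (N M : ℕ) (hN : 0 < N) (hM : 0 < M)
    (A : Finset ℝ)
    (hA : A = (Finset.range N ×ˢ Finset.range M).image
      (fun p => (p.1 : ℝ) + (p.2 : ℝ) * Real.sqrt 2)) :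
    A.card = N * M ∧
      (Finset.image₂ (fun a b => a + Real.sqrt 2 * b) A A).card ≤ (N + 2 * M) * (M + N) := by
  subst hA
  have hs : Real.sqrt 2 * Real.sqrt 2 = 2 := Real.mul_self_sqrt (by norm_num)
  constructor
  · rw [Finset.card_image_of_injective, Finset.card_product, Finset.card_range, Finset.card_range]
    rintro ⟨a, b⟩ ⟨c, d⟩ h
    simp only at h
    have hbd : b = d := by
      by_contra hne
      have h0 : (d : ℝ) - (b : ℝ) ≠ 0 := by
        intro h1
        exact hne (by exact_mod_cast (sub_eq_zero.mp h1).symm)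
      apply irrational_sqrt_two
      refine ⟨((a : ℚ) - c) / ((d : ℚ) - b), ?_⟩
      push_cast
      rw [div_eq_iff h0]
      linarith
    subst hbd
    have hac : (a : ℝ) = c := by linarith
    have hac' : a = c := by exact_mod_cast hac
    rw [hac']
  · calc _ ≤ ((Finset.range (N + 2 * M) ×ˢ Finset.range (M + N)).image
        (fun p => (p.1 : ℝ) + (p.2 : ℝ) * Real.sqrt 2)).card := by
          apply Finset.card_le_card
          intro z hz
          simp only [Finset.mem_image₂, Finset.mem_image, Finset.mem_product,
            Finset.mem_range] at hz
          obtain ⟨_, ⟨⟨x, y⟩, ⟨hx, hy⟩, rfl⟩, _, ⟨⟨u, v⟩, ⟨hu, hv⟩, rfl⟩, rfl⟩ := hz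
          simp only at hx hy hu hv
          simp only [Finset.mem_image, Finset.mem_product, Finset.mem_range]
          refine ⟨(x + 2 * v, y + u), ⟨by simp only; omega, by simp only; omega⟩, ?_⟩
          push_cast
          linear_combination (-(v : ℝ)) * hs
      _ ≤ (Finset.range (N + 2 * M) ×ˢ Finset.range (M + N)).card := Finset.card_image_le
      _ = _ := by rw [Finset.card_product, Finset.card_range, Finset.card_range]
end

section
/- Let T : ℝ² → ℝ² be the linear map T(x,y) = (2y, x) and let Ω ⊂ ℝ² be a compact set. Then μ(Ω + T(Ω)) ≥ (1+√2)²·μ(Ω), where μ is two-dimensional Lebesgue measure. -/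
open scoped Pointwise

open MeasureTheory in
/-- One-dimensional Brunn-Minkowski for nonempty compact sets. -/
lemma bm1_compact (K L : Set ℝ) (hK : IsCompact K) (hL : IsCompact L)
    (hK0 : K.Nonempty) (hL0 : L.Nonempty) :
    volume K + volume L ≤ volume (K + L) := by
  obtain ⟨k, hk, hkm⟩ := hK.exists_isGreatest hK0
  obtain ⟨l, hl, hlm⟩ := hL.exists_isLeast hL0
  have e1 : volume ((fun x => x + l) '' K) = volume K := by
    rw [Set.image_add_right, measure_preimage_add_right]
  have e2 : volume ((fun x => k + x) '' L) = volume L := by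
    rw [Set.image_add_left, measure_preimage_add]
  have hm : MeasurableSet ((fun x => k + x) '' L) :=
    (hL.image (by fun_prop)).measurableSet
  have hd : AEDisjoint volume ((fun x => x + l) '' K) ((fun x => k + x) '' L) := by
    have : ((fun x => x + l) '' K) ∩ ((fun x => k + x) '' L) ⊆ {k + l} := by
      rintro _ ⟨⟨x, hx, rfl⟩, ⟨y, hy, hxy⟩⟩
      have h1 := hkm hx
      have h2 := hlm hy
      simp only [Set.mem_singleton_iff] at *
      linarith
    exact measure_mono_null this (by simp)
  rw [← e1, ← e2, ← measure_union₀ hm.nullMeasurableSet hd]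
  apply measure_mono
  rintro _ (⟨x, hx, rfl⟩ | ⟨y, hy, rfl⟩)
  · exact Set.add_mem_add hx hl
  · exact Set.add_mem_add hk hy

open MeasureTheory in
/-- One-dimensional Brunn-Minkowski for nonempty measurable sets. -/
lemma bm1 (X Y : Set ℝ) (hX : MeasurableSet X) (hY : MeasurableSet Y)
    (hX0 : X.Nonempty) (hY0 : Y.Nonempty) :
    volume X + volume Y ≤ volume (X + Y) := by
  obtain ⟨x, hx⟩ := hX0
  obtain ⟨y, hy⟩ := hY0
  have key : ∀ K, (K ⊆ X ∧ IsCompact K) → ∀ L, (L ⊆ Y ∧ IsCompact L) →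
      volume K + volume L ≤ volume (X + Y) := by
    rintro K ⟨hKX, hK⟩ L ⟨hLY, hL⟩
    calc volume K + volume L ≤ volume (insert x K) + volume (insert y L) := by
          gcongr <;> exact Set.subset_insert _ _
      _ ≤ volume (insert x K + insert y L) :=
          bm1_compact _ _ (hK.insert x) (hL.insert y) (Set.insert_nonempty _ _)
            (Set.insert_nonempty _ _)
      _ ≤ volume (X + Y) := measure_mono
          (Set.add_subset_add (Set.insert_subset hx hKX) (Set.insert_subset hy hLY))
  rw [hX.measure_eq_iSup_isCompact, hY.measure_eq_iSup_isCompact]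
  simp only [iSup_and']
  exact ENNReal.biSup_add_biSup_le' (p := fun K => K ⊆ X ∧ IsCompact K)
    (q := fun L => L ⊆ Y ∧ IsCompact L) ⟨∅, Set.empty_subset _, isCompact_empty⟩
    ⟨∅, Set.empty_subset _, isCompact_empty⟩ key

open MeasureTheory in
/-- Lengths of the vertical sections of a compact planar set. -/
noncomputable def secLen (A : Set (ℝ × ℝ)) (x : ℝ) : ℝ := (volume (Prod.mk x ⁻¹' A)).toReal

lemma sec_compact {A : Set (ℝ × ℝ)} (hA : IsCompact A) (x : ℝ) :
    IsCompact (Prod.mk x ⁻¹' A) := by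
  apply (hA.image continuous_snd).of_isClosed_subset
  · exact hA.isClosed.preimage (by fun_prop)
  · intro y hy
    exact ⟨(x, y), hy, rfl⟩

lemma secLen_nonneg (A : Set (ℝ × ℝ)) (x : ℝ) : 0 ≤ secLen A x := ENNReal.toReal_nonneg

open MeasureTheory in
lemma secLen_bdd {A : Set (ℝ × ℝ)} (hA : IsCompact A) : BddAbove (Set.range (secLen A)) := by
  refine ⟨(volume (Prod.snd '' A)).toReal, ?_⟩
  rintro _ ⟨x, rfl⟩
  apply ENNReal.toReal_mono (hA.image continuous_snd).measure_lt_top.ne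
  apply measure_mono
  intro y hy
  exact ⟨(x, y), hy, rfl⟩

lemma secLen_meas {A : Set (ℝ × ℝ)} (hA : IsCompact A) : Measurable (secLen A) :=
  (measurable_measure_prodMk_left hA.measurableSet).ennreal_toReal

open MeasureTheory in
lemma secLen_lintegral {A : Set (ℝ × ℝ)} (hA : IsCompact A) :
    volume A = ∫⁻ x, ENNReal.ofReal (secLen A x) := by
  rw [Measure.volume_eq_prod, Measure.prod_apply hA.measurableSet]
  congr 1
  ext x
  rw [secLen, ENNReal.ofReal_toReal (sec_compact hA x).measure_lt_top.ne]

lemma nonempty_of_secLen {A : Set (ℝ × ℝ)} {x : ℝ} (h : 0 < secLen A x) :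
    (Prod.mk x ⁻¹' A).Nonempty := by
  rw [Set.nonempty_iff_ne_empty]
  intro h0
  simp [secLen, h0] at h

open MeasureTheory in
lemma secLen_add {A B : Set (ℝ × ℝ)} (hA : IsCompact A) (hB : IsCompact B) {x y : ℝ}
    (hx : 0 < secLen A x) (hy : 0 < secLen B y) :
    secLen A x + secLen B y ≤ secLen (A + B) (x + y) := by
  have h := bm1_compact _ _ (sec_compact hA x) (sec_compact hB y) (nonempty_of_secLen hx)
    (nonempty_of_secLen hy)
  unfold secLen
  rw [← ENNReal.toReal_add (sec_compact hA x).measure_lt_top.ne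
    (sec_compact hB y).measure_lt_top.ne]
  apply ENNReal.toReal_mono (sec_compact (hA.add hB) _).measure_lt_top.ne
  refine h.trans (measure_mono ?_)
  rintro _ ⟨u, hu, v, hv, rfl⟩
  exact ⟨(x, u), hu, (y, v), hv, rfl⟩

open MeasureTheory in
lemma vol_div {A : Set (ℝ × ℝ)} (hA : IsCompact A) {a : ℝ} (ha : 0 < a) :
    volume A = ENNReal.ofReal a * ∫⁻ t in Set.Ioi (0 : ℝ), volume {x | t < secLen A x / a} := by
  rw [← lintegral_eq_lintegral_meas_lt (μ := volume) (f := fun x => secLen A x / a)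
    (Filter.Eventually.of_forall fun x => div_nonneg (secLen_nonneg A x) ha.le)
    ((secLen_meas hA).div_const a).aemeasurable,
    ← lintegral_const_mul _ ((secLen_meas hA).div_const a).ennreal_ofReal, secLen_lintegral hA]
  congr 1
  ext x
  rw [← ENNReal.ofReal_mul ha.le, mul_div_cancel₀ _ ha.ne']

open MeasureTheory in
lemma sup_pos {A : Set (ℝ × ℝ)} (hA : IsCompact A) (h0 : volume A ≠ 0) :
    0 < ⨆ x, secLen A x := by
  by_contra hn
  apply h0
  rw [secLen_lintegral hA]
  have : ∀ x, ENNReal.ofReal (secLen A x) = 0 := fun x =>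
    ENNReal.ofReal_eq_zero.2 ((le_ciSup (secLen_bdd hA) x).trans (not_lt.1 hn))
  simp [this]

open MeasureTheory in
/-- Planar Brunn-Minkowski, in Bonnesen form. -/
lemma bm2 {A B : Set (ℝ × ℝ)} (hA : IsCompact A) (hB : IsCompact B)
    (hA0 : volume A ≠ 0) (hB0 : volume B ≠ 0) :
    ∃ a b : ℝ, 0 < a ∧ 0 < b ∧
      (a + b) * ((volume A).toReal / a + (volume B).toReal / b) ≤ (volume (A + B)).toReal := by
  set a := ⨆ x, secLen A x with ha_def
  set b := ⨆ x, secLen B x with hb_def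
  have ha : 0 < a := sup_pos hA hA0
  have hb : 0 < b := sup_pos hB hB0
  refine ⟨a, b, ha, hb, ?_⟩
  have hab : 0 < a + b := add_pos ha hb
  have key : ∀ t ∈ Set.Ioi (0 : ℝ), volume {x | t < secLen A x / a} +
      volume {x | t < secLen B x / b} ≤ volume {x | t < secLen (A + B) x / (a + b)} := by
    intro t (ht : 0 < t)
    rcases lt_or_ge t 1 with h1 | h1
    · have nA : {x | t < secLen A x / a}.Nonempty := by
        obtain ⟨x, hx⟩ := exists_lt_of_lt_ciSup (show t * a < ⨆ x, secLen A x by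
          rw [← ha_def]; nlinarith)
        exact ⟨x, (lt_div_iff₀ ha).2 hx⟩
      have nB : {x | t < secLen B x / b}.Nonempty := by
        obtain ⟨x, hx⟩ := exists_lt_of_lt_ciSup (show t * b < ⨆ x, secLen B x by
          rw [← hb_def]; nlinarith)
        exact ⟨x, (lt_div_iff₀ hb).2 hx⟩
      refine (bm1 _ _ (measurableSet_lt measurable_const ((secLen_meas hA).div_const a))
        (measurableSet_lt measurable_const ((secLen_meas hB).div_const b)) nA nB).trans
        (measure_mono ?_)
      rintro _ ⟨x, hx, y, hy, rfl⟩
      simp only [Set.mem_setOf_eq] at hx hy ⊢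
      rw [lt_div_iff₀ ha] at hx
      rw [lt_div_iff₀ hb] at hy
      rw [lt_div_iff₀ hab]
      have := secLen_add hA hB ((mul_pos ht ha).trans hx) ((mul_pos ht hb).trans hy)
      linarith
    · have eA : {x | t < secLen A x / a} = ∅ := by
        ext x
        simp only [Set.mem_setOf_eq, Set.mem_empty_iff_false, iff_false, not_lt]
        exact ((div_le_one ha).2 (le_ciSup (secLen_bdd hA) x)).trans h1
      have eB : {x | t < secLen B x / b} = ∅ := by
        ext x
        simp only [Set.mem_setOf_eq, Set.mem_empty_iff_false, iff_false, not_lt]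
        exact ((div_le_one hb).2 (le_ciSup (secLen_bdd hB) x)).trans h1
      simp [eA, eB]
  have hint : (∫⁻ t in Set.Ioi (0 : ℝ), volume {x | t < secLen A x / a}) +
      (∫⁻ t in Set.Ioi (0 : ℝ), volume {x | t < secLen B x / b}) ≤
      ∫⁻ t in Set.Ioi (0 : ℝ), volume {x | t < secLen (A + B) x / (a + b)} := by
    rw [← lintegral_add_left]
    · exact setLIntegral_mono' measurableSet_Ioi key
    · exact Antitone.measurable fun s t hst => measure_mono fun x hx => lt_of_le_of_lt hst hx
  have vA := vol_div hA ha
  have vB := vol_div hB hb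
  have vC := vol_div (hA.add hB) hab
  generalize (∫⁻ t in Set.Ioi (0 : ℝ), volume {x | t < secLen A x / a}) = I at *
  generalize (∫⁻ t in Set.Ioi (0 : ℝ), volume {x | t < secLen B x / b}) = J at *
  generalize (∫⁻ t in Set.Ioi (0 : ℝ), volume {x | t < secLen (A + B) x / (a + b)}) = H at *
  have hH : H ≠ ⊤ := by
    rintro rfl
    have := (hA.add hB).measure_lt_top (μ := volume)
    rw [vC, ENNReal.mul_top (by simpa using hab)] at this
    exact lt_irrefl _ this
  have hI : I ≠ ⊤ := ne_top_of_le_ne_top hH (le_self_add.trans hint)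
  have hJ : J ≠ ⊤ := ne_top_of_le_ne_top hH (le_add_self.trans hint)
  have hr := ENNReal.toReal_mono hH hint
  rw [ENNReal.toReal_add hI hJ] at hr
  rw [vA, vB, vC]
  simp only [ENNReal.toReal_mul, ENNReal.toReal_ofReal ha.le, ENNReal.toReal_ofReal hb.le,
    ENNReal.toReal_ofReal hab.le]
  rw [mul_div_cancel_left₀ _ ha.ne', mul_div_cancel_left₀ _ hb.ne']
  exact mul_le_mul_of_nonneg_left hr hab.le

open MeasureTheory in
lemma vol_T (Ω : Set (ℝ × ℝ)) :
    volume ((fun p : ℝ × ℝ => (2 * p.2, p.1)) '' Ω) = 2 * volume Ω := by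
  have h := Measure.addHaar_image_linearMap (volume : Measure (ℝ × ℝ))
    (Matrix.toLin (Module.Basis.finTwoProd ℝ) (Module.Basis.finTwoProd ℝ) !![0, 2; 1, 0]) Ω
  have e : (⇑(Matrix.toLin (Module.Basis.finTwoProd ℝ) (Module.Basis.finTwoProd ℝ)
      !![0, 2; 1, 0]) : ℝ × ℝ → ℝ × ℝ) = fun p : ℝ × ℝ => (2 * p.2, p.1) := by
    ext p <;> simp [Matrix.toLin_finTwoProd_apply]
  rw [e, LinearMap.det_toLin, Matrix.det_fin_two_of] at h
  rw [h]
  norm_num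

/-- Let `T : ℝ² → ℝ²` be `T (x, y) = (2y, x)` and let `Ω ⊆ ℝ²` be compact. Then
`μ(Ω + T(Ω)) ≥ (1+√2)²·μ(Ω)`, where `μ` is two-dimensional Lebesgue measure. -/
theorem stmt_12 (Ω : Set (ℝ × ℝ)) (hΩ : IsCompact Ω) :
    MeasureTheory.volume (Ω + (fun p : ℝ × ℝ => (2 * p.2, p.1)) '' Ω) ≥
      ENNReal.ofReal ((1 + Real.sqrt 2) ^ 2) * MeasureTheory.volume Ω := by
  by_cases h0 : MeasureTheory.volume Ω = 0
  · simp [h0]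
  have hB : IsCompact ((fun p : ℝ × ℝ => (2 * p.2, p.1)) '' Ω) := hΩ.image (by fun_prop)
  obtain ⟨a, b, ha, hb, h⟩ := bm2 hΩ hB h0 (by rw [vol_T]; simp [h0])
  rw [vol_T, ENNReal.toReal_mul] at h
  have hfin := hΩ.measure_lt_top (μ := MeasureTheory.volume)
  have hfinC := (hΩ.add hB).measure_lt_top (μ := MeasureTheory.volume)
  rw [ge_iff_le, ← ENNReal.ofReal_toReal hfin.ne, ← ENNReal.ofReal_toReal hfinC.ne,
    ← ENNReal.ofReal_mul (by positivity)]
  apply ENNReal.ofReal_le_ofReal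
  refine le_trans ?_ h
  have hm : 0 ≤ (MeasureTheory.volume Ω).toReal := ENNReal.toReal_nonneg
  generalize (MeasureTheory.volume Ω).toReal = m at *
  have hs : Real.sqrt 2 ^ 2 = 2 := Real.sq_sqrt (by norm_num)
  have e : (a + b) * (m / a + (2 : ENNReal).toReal * m / b) - (1 + Real.sqrt 2) ^ 2 * m
      = m * (b - Real.sqrt 2 * a) ^ 2 / (a * b) := by
    simp only [ENNReal.toReal_ofNat]
    field_simp
    ring_nf
    rw [hs]
    ring
  have : 0 ≤ m * (b - Real.sqrt 2 * a) ^ 2 / (a * b) := by positivity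
  linarith
end

section
/- Let λ₁ and λ₂ be transcendental real numbers and let n be a positive integer. Then the minimum of |A + λ₁·A| over all finite sets A ⊂ ℝ with |A| = n equals the minimum of |A + λ₂·A| over all finite sets A ⊂ ℝ with |A| = n. -/
theorem aux_lin (K V W : Type) [Field K] [Countable K] [Infinite K] [AddCommGroup V] [AddCommGroup W]
    [Module K V] [Module K W] (hV : Cardinal.mk V = Cardinal.continuum)
    (hW : Cardinal.mk W = Cardinal.continuum) : 
    ∃ φ : V ≃+ W, ∀ (k : K) x, φ (k • x) = k • φ x := by
  suffices h : Nonempty (V ≃ₗ[K] W) by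
    obtain ⟨e⟩ := h
    exact ⟨e.toAddEquiv, fun k x => e.map_smul k x⟩
  have hK : Cardinal.mk K < Cardinal.continuum :=
    (Cardinal.mk_le_aleph0).trans_lt Cardinal.aleph0_lt_continuum
  apply nonempty_linearEquiv_of_rank_eq
  rw [Module.Free.rank_eq_mk_of_infinite_lt K V (by simpa [hV] using hK),
    Module.Free.rank_eq_mk_of_infinite_lt K W (by simpa [hW] using hK), hV, hW]

theorem aux_hom (K : Type) [Field K] [Countable K] [Infinite K] (f g : K →+* ℝ) :
    ∃ φ : ℝ ≃+ ℝ, ∀ k x, φ (f k * x) = g k * φ x := by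
  exact @aux_lin K ℝ ℝ _ _ _ _ _ (Module.compHom ℝ f) (Module.compHom ℝ g)
    Cardinal.mk_real Cardinal.mk_real

theorem aux_countable : Countable (FractionRing (Polynomial ℚ)) := by
  have : Countable (Polynomial ℚ) := by
    rw [← Cardinal.mk_le_aleph0_iff]
    simp
  rw [← Cardinal.mk_le_aleph0_iff] at this ⊢
  exact (Localization.cardinalMk_le _).trans this

theorem aux_equiv (l₁ l₂ : ℝ) (h₁ : Transcendental ℚ l₁) (h₂ : Transcendental ℚ l₂) :
    ∃ φ : ℝ ≃+ ℝ, ∀ x, φ (l₁ * x) = l₂ * φ x := by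
  rw [transcendental_iff_injective] at h₁ h₂
  have := aux_countable
  have : Infinite (FractionRing (Polynomial ℚ)) :=
    Infinite.of_injective _ (IsFractionRing.injective (Polynomial ℚ) _)
  obtain ⟨φ, hφ⟩ := aux_hom (FractionRing (Polynomial ℚ))
    (IsFractionRing.lift (g := (Polynomial.aeval l₁ : Polynomial ℚ →ₐ[ℚ] ℝ).toRingHom) h₁)
    (IsFractionRing.lift (g := (Polynomial.aeval l₂ : Polynomial ℚ →ₐ[ℚ] ℝ).toRingHom) h₂)
  refine ⟨φ, fun x => ?_⟩
  have := hφ (algebraMap (Polynomial ℚ) _ Polynomial.X) x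
  rw [IsFractionRing.lift_algebraMap, IsFractionRing.lift_algebraMap] at this
  simpa using this

theorem aux_sub (l₁ l₂ : ℝ) (h₁ : Transcendental ℚ l₁) (h₂ : Transcendental ℚ l₂) (n : ℕ) :
    {m : ℕ | ∃ A : Finset ℝ, A.card = n ∧
        m = (Finset.image₂ (fun a b => a + l₁ * b) A A).card} ⊆
      {m : ℕ | ∃ A : Finset ℝ, A.card = n ∧
        m = (Finset.image₂ (fun a b => a + l₂ * b) A A).card} := by
  obtain ⟨φ, hφ⟩ := aux_equiv l₁ l₂ h₁ h₂
  rintro m ⟨A, hA, rfl⟩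
  refine ⟨A.image φ, by rw [Finset.card_image_of_injective _ φ.injective, hA], ?_⟩
  rw [← Finset.card_image_of_injective _ φ.injective, Finset.image_image₂,
    Finset.image₂_image_left, Finset.image₂_image_right]
  simp only [map_add, hφ]


/-- Let `λ₁, λ₂` be transcendental real numbers and `n` a positive integer. Then the
minimum of `|A + λ₁·A|` over finite `A ⊆ ℝ` with `|A| = n` equals the minimum of
`|A + λ₂·A|` over finite `A ⊆ ℝ` with `|A| = n`. -/
theorem stmt_16 (l₁ l₂ : ℝ) (h₁ : Transcendental ℚ l₁) (h₂ : Transcendental ℚ l₂)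
    (n : ℕ) (hn : 0 < n) :
    sInf {m : ℕ | ∃ A : Finset ℝ, A.card = n ∧
        m = (Finset.image₂ (fun a b => a + l₁ * b) A A).card} =
      sInf {m : ℕ | ∃ A : Finset ℝ, A.card = n ∧
        m = (Finset.image₂ (fun a b => a + l₂ * b) A A).card} := by
  rw [Set.Subset.antisymm (aux_sub l₁ l₂ h₁ h₂ n) (aux_sub l₂ l₁ h₂ h₁ n)]
end
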